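/- arXiv:1909.13388 — 3 statements merged into one kernel-verified Lean document; each statement's English description precedes it below -/
import Mathlib

section
/- Let n ≥ 1 and 0 ≤ m ≤ n, and let k be an integer with 1 ≤ k ≤ n such that n − k is even. Then the number of ordered pairs (u, v) of n-cycles on [n] such that the product u∘v has exactly k cycles and the elements 1, …, m lie in pairwise distinct cycles of u∘v equals 2·(n−1)!·C_m(n+1, k) / ((n+m)(n+1−m)); equivalently, (n+m)(n+1−m) times this number of pairs equals 2·(n−1)!·C_m(n+1, k). -/
open Equiv Finset

noncomputable section

/-- The number of cycles of a permutation of `Fin n`, counting fixed points as cycles. -/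
def cycleCount {n : ℕ} (σ : Equiv.Perm (Fin n)) : ℕ :=
  σ.cycleType.card + (Finset.univ.filter fun x => σ x = x).card

/-- A permutation of `Fin n` consisting of a single cycle of length `n`
(equivalently, having exactly one cycle, fixed points counting as cycles). -/
def IsFullCycle {n : ℕ} (σ : Equiv.Perm (Fin n)) : Prop :=
  cycleCount σ = 1

/-- `σ` separates the first `m` elements (`1, …, m`, i.e. indices `0, …, m-1`):
they lie in pairwise distinct cycles of `σ`. -/
def Separates {n : ℕ} (m : ℕ) (σ : Equiv.Perm (Fin n)) : Prop :=
  ∀ i j : Fin n, (i : ℕ) < m → (j : ℕ) < m → i ≠ j → ¬ σ.SameCycle i j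

/-- `C_m(N, k)`: the number of permutations of `[N]` with exactly `k` cycles
that separate the first `m` elements. -/
def sepCount (N m k : ℕ) : ℕ :=
  Nat.card {σ : Equiv.Perm (Fin N) // cycleCount σ = k ∧ Separates m σ}

/-- `C(N, k)`: the signless Stirling number of the first kind, i.e. the number of
permutations of `[N]` with exactly `k` cycles (fixed points counting as cycles). -/
def stirlingCycle (N k : ℕ) : ℕ :=
  Nat.card {σ : Equiv.Perm (Fin N) // cycleCount σ = k}

section helpers
variable {α : Type*} [DecidableEq α]

theorem sameCycle_induct {σ : Perm α} {r : α → α → Prop} (hr : Equivalence r)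
    (h : ∀ z, r z (σ z)) {x y : α} (hxy : σ.SameCycle x y) : r x y := by
  obtain ⟨i, rfl⟩ := hxy
  induction i using Int.induction_on with
  | zero => exact hr.refl _
  | succ i ih =>
    refine hr.trans ih ?_
    rw [add_comm, zpow_add, zpow_one, Perm.mul_apply]
    exact h _
  | pred i ih =>
    refine hr.trans ih ?_
    have := h ((σ ^ (-(i : ℤ) - 1)) x)
    rw [← Perm.mul_apply, ← zpow_one_add] at this
    rw [show (1 + (-(i : ℤ) - 1)) = -(i : ℤ) by ring] at this
    exact hr.symm this

theorem sc_apply (σ : Perm α) (x : α) : σ.SameCycle x (σ x) := ⟨1, by simp⟩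

theorem sameCycle_insert {B : Perm α} {a b : α} (hb : B b = b) (hab : a ≠ b) (z z' : α) :
    (B * swap a b).SameCycle z z' ↔
      B.SameCycle (if z = b then a else z) (if z' = b then a else z') := by
  have e1 : (B * swap a b) a = b := by simp [hb]
  have e2 : (B * swap a b) b = B a := by simp
  have e3 : ∀ x, x ≠ a → x ≠ b → (B * swap a b) x = B x := by
    intro x h1 h2; simp [swap_apply_of_ne_of_ne h1 h2]
  constructor
  · intro h
    refine sameCycle_induct (r := fun z z' => B.SameCycle (if z = b then a else z)
      (if z' = b then a else z')) ⟨fun _ => Perm.SameCycle.refl _ _, fun h => h.symm,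
      fun h h' => h.trans h'⟩ ?_ h
    intro x
    by_cases h1 : x = a
    · subst h1; rw [e1]; simp only [if_neg hab, if_true]; exact Perm.SameCycle.refl _ _
    by_cases h2 : x = b
    · subst h2; rw [e2]
      have : B a ≠ x := fun h => hab (B.injective (h.trans hb.symm))
      simp only [if_neg this, if_true]
      exact sc_apply _ _
    rw [e3 x h1 h2]
    have : B x ≠ b := fun h => h2 (B.injective (h.trans hb.symm))
    simp only [if_neg this, if_neg h2]
    exact sc_apply _ _
  · intro h
    have key : ∀ x y, B.SameCycle x y → (B * swap a b).SameCycle x y := by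
      intro x y hxy
      refine sameCycle_induct (r := fun z z' => (B * swap a b).SameCycle z z')
        ⟨fun _ => Perm.SameCycle.refl _ _, fun h => h.symm, fun h h' => h.trans h'⟩ ?_ hxy
      intro x
      by_cases h1 : x = a
      · subst h1; rw [← e2]
        refine Perm.SameCycle.trans (y := b) ?_ ?_
        · have := sc_apply (B * swap x b) x
          rwa [e1] at this
        · simp only [Perm.sameCycle_apply_right]; exact Perm.SameCycle.refl _ _
      by_cases h2 : x = b
      · subst h2; rw [hb]
      rw [← e3 x h1 h2]; simp only [Perm.sameCycle_apply_right]; exact Perm.SameCycle.refl _ _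
    have hp : ∀ x, (B * swap a b).SameCycle x (if x = b then a else x) := by
      intro x
      split_ifs with hx
      · subst hx
        have := sc_apply (B * swap a x) a
        rw [e1] at this
        exact this.symm
      · exact Perm.SameCycle.refl _ _
    exact (hp z).trans ((key _ _ h).trans (hp z').symm)

def FullOn (S : Finset α) (σ : Perm α) : Prop :=
  (∀ x, x ∉ S → σ x = x) ∧ ∀ x ∈ S, ∀ y ∈ S, σ.SameCycle x y

theorem FullOn.mem_apply {S : Finset α} {σ : Perm α} (h : ∀ x, x ∉ S → σ x = x) {x : α}
    (hx : x ∈ S) : σ x ∈ S := by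
  by_contra hc
  have h2 := σ.injective (h _ hc)
  rw [h2] at hc
  exact hc hx

theorem FullOn.inv {S : Finset α} {σ : Perm α} (h : FullOn S σ) : FullOn S σ⁻¹ :=
  ⟨fun x hx => by rw [Perm.inv_eq_iff_eq, h.1 x hx], fun x hx y hy => (h.2 x hx y hy).inv⟩

theorem fullOn_insert {T : Finset α} {B : Perm α} {a e : α} (he : e ∉ T) (ha : a ∈ T)
    (hB : B e = e) : FullOn (insert e T) (B * swap a e) ↔ FullOn T B := by
  have hae : a ≠ e := fun h => he (h ▸ ha)
  constructor
  · rintro ⟨h1, h2⟩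
    refine ⟨fun x hx => ?_, fun x hx y hy => ?_⟩
    · by_cases hxe : x = e
      · rw [hxe, hB]
      have := h1 x (by simp [hx, hxe])
      rwa [Perm.mul_apply, swap_apply_of_ne_of_ne (ne_of_mem_of_not_mem ha hx).symm hxe] at this
    · have := (sameCycle_insert hB hae x y).1 (h2 x (by simp [hx]) y (by simp [hy]))
      rwa [if_neg (ne_of_mem_of_not_mem hx he), if_neg (ne_of_mem_of_not_mem hy he)] at this
  · rintro ⟨h1, h2⟩
    refine ⟨fun x hx => ?_, fun x hx y hy => ?_⟩
    · simp only [mem_insert, not_or] at hx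
      rw [Perm.mul_apply, swap_apply_of_ne_of_ne (ne_of_mem_of_not_mem ha hx.2).symm hx.1, h1 x hx.2]
    · rw [sameCycle_insert hB hae]
      apply h2
      · split_ifs with h
        · exact ha
        · simpa [h] using hx
      · split_ifs with h
        · exact ha
        · simpa [h] using hy

variable [Fintype α]
open Classical in
theorem pairs_count (N : ℕ) : ∀ (S : Finset α), S.card = N + 2 → ∀ w : Perm α,
    (∀ x, x ∉ S → w x = x) → Perm.sign w = -1 →
    ((univ : Finset (Perm α × α)).filter (fun q => q.2 ∈ S ∧ FullOn (S.erase q.2) q.1 ∧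
      FullOn S (w * q.1⁻¹))).card = 2 * N.factorial := by
  induction N with
  | zero =>
    intro S hS w hw hsw
    obtain ⟨x, y, hxy, rfl⟩ := card_eq_two.1 hS
    have hone : ∀ (B : Perm α) (f : α), f ∈ ({x, y} : Finset α) →
        (FullOn (({x, y} : Finset α).erase f) B ↔ B = 1) := by
      intro B f hf
      obtain ⟨g, hg⟩ : ∃ g, ({x, y} : Finset α).erase f = {g} := by
        rw [← card_eq_one, card_erase_of_mem hf, hS]
      rw [hg]
      constructor
      · rintro ⟨h1, -⟩
        ext z
        by_cases hz : z = g
        · have := FullOn.mem_apply h1 (x := g) (by simp)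
          simp only [mem_singleton] at this
          rw [hz, this]; rfl
        · rw [h1 z (by simpa using hz)]; rfl
      · rintro rfl
        refine ⟨fun _ _ => rfl, fun z hz z' hz' => ?_⟩
        rw [mem_singleton.1 hz, mem_singleton.1 hz']
    have hwx : w x = y := by
      have hm := FullOn.mem_apply hw (x := x) (by simp)
      simp only [mem_insert, mem_singleton] at hm
      rcases hm with hm | hm
      · exfalso
        have hm2 := FullOn.mem_apply hw (x := y) (by simp)
        simp only [mem_insert, mem_singleton] at hm2
        have hy : w y = y := by
          rcases hm2 with h | h
          · exact absurd (w.injective (hm.trans h.symm)) hxy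
          · exact h
        have : w = 1 := by
          ext z
          by_cases h1 : z = x
          · rw [h1, hm]; rfl
          by_cases h2 : z = y
          · rw [h2, hy]; rfl
          rw [hw z (by simp [h1, h2])]; rfl
        rw [this] at hsw
        simp at hsw
      · exact hm
    have hfull : FullOn ({x, y} : Finset α) w := by
      refine ⟨hw, ?_⟩
      have h : w.SameCycle x y := by
        rw [← hwx]; simp only [Perm.sameCycle_apply_right]; exact Perm.SameCycle.refl _ _
      intro z hz z' hz'
      simp only [mem_insert, mem_singleton] at hz hz'
      rcases hz with rfl | rfl <;> rcases hz' with rfl | rfl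
      · exact Perm.SameCycle.refl _ _
      · exact h
      · exact h.symm
      · exact Perm.SameCycle.refl _ _
    have : ((univ : Finset (Perm α × α)).filter (fun q => q.2 ∈ ({x, y} : Finset α) ∧
        FullOn (({x, y} : Finset α).erase q.2) q.1 ∧
        FullOn ({x, y} : Finset α) (w * q.1⁻¹))) = {(1 : Perm α)} ×ˢ ({x, y} : Finset α) := by
      ext ⟨B, f⟩
      simp only [mem_filter, mem_univ, true_and, mem_product]
      constructor
      · rintro ⟨h1, h2, -⟩
        exact ⟨by simpa using (hone B f h1).1 h2, h1⟩
      · rintro ⟨h1, h2⟩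
        have h1 : B = 1 := by simpa using h1
        exact ⟨h2, (hone B f h2).2 h1, by rw [h1]; simpa using hfull⟩
    rw [this, card_product, hS]; simp
  | succ N ih =>
    intro S hS w hw hsw
    obtain ⟨e, hwe⟩ : ∃ e, w e ≠ e := by
      by_contra hc
      push Not at hc
      have : w = 1 := by ext z; rw [hc z]; rfl
      rw [this] at hsw
      simp at hsw
    have heS : e ∈ S := by
      by_contra hc
      exact hwe (hw e hc)
    obtain ⟨T, heT, rfl⟩ : ∃ T, e ∉ T ∧ insert e T = S :=
      ⟨S.erase e, by simp, insert_erase heS⟩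
    have hT : T.card = N + 2 := by
      rw [card_insert_of_notMem heT] at hS; omega
    obtain ⟨a, ha⟩ : ∃ a, w a = e := w.surjective e
    have hae : a ≠ e := fun h => hwe (h ▸ ha)
    have haT : a ∈ T := by
      by_contra hc
      have := hw a (by simp [hc, hae])
      exact hae (this.symm.trans ha)
    obtain ⟨w', hw'⟩ : ∃ w' : Perm α, w' = w * swap a e := ⟨_, rfl⟩
    have hww : w = w' * swap a e := by rw [hw', mul_assoc, swap_mul_self, mul_one]
    have hw'e : w' e = e := by rw [hw']; simp [ha]
    have hw'T : ∀ x, x ∉ T → w' x = x := by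
      intro x hx
      by_cases hxe : x = e
      · rw [hxe, hw'e]
      rw [hw', Perm.mul_apply, swap_apply_of_ne_of_ne (ne_of_mem_of_not_mem haT hx).symm hxe]
      exact hw x (by simp [hx, hxe])
    have hsw' : Perm.sign w' = 1 := by
      rw [hw', Perm.sign_mul, Perm.sign_swap hae, hsw]; simp
    have hconj : ∀ (B : Perm α) (x : α), B e = e →
        swap x e * B⁻¹ = B⁻¹ * swap (B x) e := by
      intro B x hB
      have := Equiv.swap_mul_eq_mul_swap B⁻¹ x e
      rw [this]; simp [hB]
    -- the intermediate sets
    let P : Finset (Perm α) := univ.filter fun B => FullOn T B ∧ FullOn T (w' * B⁻¹)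
    let X : Finset (α × Perm α × α) := univ.filter fun q => q.1 ∈ T.erase a ∧ q.2.2 ∈ T ∧
      FullOn (T.erase q.2.2) q.2.1 ∧ FullOn T (w' * swap a q.1 * q.2.1⁻¹)
    have hX : X.card = 2 * (N + 1).factorial := by
      have : X = (T.erase a).biUnion fun b =>
          ((univ : Finset (Perm α × α)).filter (fun q => q.2 ∈ T ∧ FullOn (T.erase q.2) q.1 ∧
            FullOn T (w' * swap a b * q.1⁻¹))).image (Prod.mk b) := by
        ext ⟨b, B, c⟩
        simp only [X, mem_filter, mem_univ, true_and, mem_biUnion, mem_image]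
        constructor
        · rintro ⟨h1, h2⟩
          exact ⟨b, h1, (B, c), h2, rfl⟩
        · rintro ⟨b', h1, q, h2, h3⟩
          cases h3
          exact ⟨h1, h2⟩
      rw [this, card_biUnion]
      · simp only [card_image_of_injective _ (Prod.mk_right_injective _)]
        rw [sum_congr rfl (g := fun _ => 2 * N.factorial)]
        · rw [sum_const, card_erase_of_mem haT, hT, Nat.factorial_succ, smul_eq_mul]
          simp; ring
        · intro b hb
          simp only [mem_erase] at hb
          apply ih T hT
          · intro x hx
            rw [Perm.mul_apply, swap_apply_of_ne_of_ne (ne_of_mem_of_not_mem haT hx).symm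
              (ne_of_mem_of_not_mem hb.2 hx).symm, hw'T x hx]
          · rw [Perm.sign_mul, hsw', Perm.sign_swap (Ne.symm hb.1)]; simp
      · intro b _ b' _ hbb
        rw [Function.onFun, disjoint_left]
        simp only [mem_image]
        rintro _ ⟨q, -, rfl⟩ ⟨q', -, h⟩
        exact hbb (by simpa using (congrArg Prod.fst h).symm)
    have hX1 : (X.filter fun q => q.2.2 = q.1).card = P.card := by
      refine card_nbij' (fun q => q.2.1 * swap a q.1) (fun B => (B a, B * swap a (B a), B a))
        ?_ ?_ ?_ ?_
      · rintro ⟨b, B, c⟩ h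
        simp only [X, P, coe_filter, mem_filter, mem_univ, true_and, Set.mem_ofPred_eq,
          mem_erase] at h ⊢
        obtain ⟨⟨⟨hb1, hb2⟩, -, h3, h4⟩, rfl⟩ := h
        refine ⟨?_, ?_⟩
        · have := (fullOn_insert (T := T.erase c) (B := B) (a := a) (e := c) (by simp)
            (by simp [haT, Ne.symm hb1]) (h3.1 c (by simp))).2 h3
          rwa [insert_erase hb2] at this
        · rwa [mul_inv_rev, swap_inv, ← mul_assoc]
      · intro B h
        simp only [X, P, coe_filter, mem_filter, mem_univ, true_and, Set.mem_ofPred_eq,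
          mem_erase] at h ⊢
        obtain ⟨h1, h2⟩ := h
        have hBa : B a ∈ T := FullOn.mem_apply h1.1 haT
        have hne : B a ≠ a := by
          intro hfix
          obtain ⟨x, hx, hxa⟩ := T.exists_mem_ne (by omega) a
          obtain ⟨i, hi⟩ := h1.2 a haT x hx
          rw [Perm.zpow_apply_eq_self_of_apply_eq_self hfix] at hi
          exact hxa hi.symm
        refine ⟨⟨⟨hne, hBa⟩, hBa, ?_, ?_⟩, trivial⟩
        · rw [← fullOn_insert (T := T.erase (B a)) (a := a) (e := B a) (by simp)
            (by simp [haT, Ne.symm hne]) (by simp), insert_erase hBa, mul_assoc, swap_mul_self,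
            mul_one]
          exact h1
        · rw [mul_inv_rev, swap_inv, mul_assoc, ← mul_assoc (swap a (B a)), swap_mul_self, one_mul]
          exact h2
      · rintro ⟨b, B, c⟩ h
        simp only [X, coe_filter, mem_filter, mem_univ, true_and, Set.mem_ofPred_eq,
          mem_erase] at h ⊢
        obtain ⟨⟨⟨hb1, hb2⟩, -, h3, h4⟩, rfl⟩ := h
        have : (B * swap a c) a = c := by simp [h3.1 c (by simp)]
        simp only [this, mul_assoc, swap_mul_self, mul_one]
      · intro B h
        simp only [mul_assoc, swap_mul_self, mul_one]
    -- part one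
    have hp1 : (((univ : Finset (Perm α × α)).filter (fun q => q.2 ∈ insert e T ∧
        FullOn ((insert e T).erase q.2) q.1 ∧
        FullOn (insert e T) (w * q.1⁻¹))).filter (fun q => q.2 = e)).card = P.card := by
      have hiff : ∀ B : Perm α, FullOn T B →
          (FullOn (insert e T) (w * B⁻¹) ↔ FullOn T (w' * B⁻¹)) := by
        intro B hB
        have hBe := hB.1 e heT
        rw [hww, mul_assoc, hconj B a hBe, ← mul_assoc,
          fullOn_insert heT (FullOn.mem_apply hB.1 haT)]
        rw [Perm.mul_apply, hB.inv.1 e heT, hw'e]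
      refine card_nbij' (fun q => q.1) (fun B => (B, e)) ?_ ?_ ?_ ?_
      · rintro ⟨B, c⟩ h
        simp only [P, coe_filter, mem_filter, mem_univ, true_and, Set.mem_ofPred_eq] at h ⊢
        obtain ⟨⟨h1, h2, h3⟩, rfl⟩ := h
        rw [erase_insert heT] at h2
        exact ⟨h2, (hiff B h2).1 h3⟩
      · intro B h
        simp only [P, coe_filter, mem_filter, mem_univ, true_and, Set.mem_ofPred_eq] at h ⊢
        rw [erase_insert heT]
        exact ⟨⟨by simp, h.1, (hiff B h.1).2 h.2⟩, trivial⟩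
      · rintro ⟨B, c⟩ h
        simp only [coe_filter, mem_filter, mem_univ, true_and, Set.mem_ofPred_eq] at h ⊢
        rw [h.2]
      · intro B _; rfl
    have hkey : ∀ (B : Perm α) (b : α), B e = e → b ≠ a → b ≠ e → B a ∈ T →
        (FullOn (insert e T) (w * (B * swap b e)⁻¹) ↔ FullOn T (w' * swap a b * B⁻¹)) := by
      intro B b hBe hba hbe hBa
      have h1 : swap a e * swap b e = swap a b * swap a e := by
        rw [Equiv.mul_swap_eq_swap_mul, swap_apply_of_ne_of_ne hba hbe, swap_apply_right,
          swap_comm b a]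
      have h2 : w * (B * swap b e)⁻¹ = (w' * swap a b * B⁻¹) * swap (B a) e := by
        rw [hww, mul_inv_rev, swap_inv, mul_assoc, ← mul_assoc (swap a e), h1, mul_assoc,
          hconj B a hBe]
        simp only [mul_assoc]
      rw [h2, fullOn_insert heT hBa]
      have : B⁻¹ e = e := by rw [Perm.inv_eq_iff_eq, hBe]
      rw [Perm.mul_apply, this, Perm.mul_apply, swap_apply_of_ne_of_ne hae.symm hbe.symm, hw'e]
    have hp2 : (((univ : Finset (Perm α × α)).filter (fun q => q.2 ∈ insert e T ∧
        FullOn ((insert e T).erase q.2) q.1 ∧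
        FullOn (insert e T) (w * q.1⁻¹))).filter (fun q => ¬ q.2 = e)).card =
        (X.filter fun q => ¬ q.2.2 = q.1).card := by
      refine card_nbij' (fun q => (q.1⁻¹ e, q.1 * swap (q.1⁻¹ e) e, q.2))
        (fun q => (q.2.1 * swap q.1 e, q.2.2)) ?_ ?_ ?_ ?_
      · rintro ⟨B, c⟩ h
        simp only [X, coe_filter, mem_filter, mem_univ, true_and, Set.mem_ofPred_eq,
          mem_insert, mem_erase] at h ⊢
        obtain ⟨⟨h1, h2, h3⟩, hce⟩ := h
        have hcT : c ∈ T := by tauto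
        have hBc : B c = c := h2.1 c (by simp)
        obtain ⟨b, hb⟩ : ∃ b, B b = e := B.surjective e
        have hBi : B⁻¹ e = b := by rw [Perm.inv_eq_iff_eq, hb]
        rw [hBi]
        have hbc : b ≠ c := by rintro rfl; exact hce (hBc.symm.trans hb)
        have hbe : b ≠ e := by
          rintro rfl
          obtain ⟨x, hx, hxa⟩ := T.exists_mem_ne (by omega) c
          obtain ⟨i, hi⟩ := h2.2 b (by simp [Ne.symm hce]) x (by simp [hx, hxa])
          rw [Perm.zpow_apply_eq_self_of_apply_eq_self hb] at hi
          exact heT (hi ▸ hx)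
        have hbT : b ∈ T := by
          by_contra hc
          exact hbe ((h2.1 b (by simp [hc, hbe])).symm.trans hb)
        obtain ⟨B', hB'⟩ : ∃ B' : Perm α, B' = B * swap b e := ⟨_, rfl⟩
        have hBB : B = B' * swap b e := by rw [hB', mul_assoc, swap_mul_self, mul_one]
        have hB'e : B' e = e := by rw [hB']; simp [hb]
        have hba : b ≠ a := by
          rintro rfl
          rw [hBB, hww, mul_inv_rev, swap_inv, mul_assoc, ← mul_assoc (swap b e),
            swap_mul_self, one_mul] at h3
          obtain ⟨i, hi⟩ := h3.2 e (by simp) b (by simp [haT])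
          rw [Perm.zpow_apply_eq_self_of_apply_eq_self] at hi
          · exact hbe hi.symm
          · rw [Perm.mul_apply, Perm.inv_eq_iff_eq.2 hB'e.symm, hw'e]
        have hfB' : FullOn (T.erase c) B' := by
          rw [erase_insert_of_ne (Ne.symm hce), hBB, fullOn_insert (by simp [heT])
            (by simp [hbT, hbc]) hB'e] at h2
          exact h2
        have hB'a : B' a ∈ T := FullOn.mem_apply (S := T)
          (fun x hx => hfB'.1 x (fun h => hx (mem_of_mem_erase h))) haT
        rw [← hB']
        refine ⟨⟨⟨hba, hbT⟩, hcT, hfB', ?_⟩, hbc.symm⟩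
        rw [← hkey B' b hB'e hba hbe hB'a, ← hBB]
        exact h3
      · rintro ⟨b, B, c⟩ h
        simp only [X, coe_filter, mem_filter, mem_univ, true_and, Set.mem_ofPred_eq,
          mem_insert, mem_erase] at h ⊢
        obtain ⟨⟨⟨hba, hbT⟩, hcT, h3, h4⟩, hcb⟩ := h
        have hce : c ≠ e := fun h => heT (h ▸ hcT)
        have hbe : b ≠ e := fun h => heT (h ▸ hbT)
        have hBe : B e = e := h3.1 e (by simp [heT])
        have hBa : B a ∈ T := FullOn.mem_apply (S := T)
          (fun x hx => h3.1 x (fun h => hx (mem_of_mem_erase h))) haT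
        refine ⟨⟨Or.inr hcT, ?_, ?_⟩, hce⟩
        · rw [erase_insert_of_ne (Ne.symm hce), fullOn_insert (by simp [heT])
            (by simp [hbT, Ne.symm hcb]) hBe]
          exact h3
        · exact (hkey B b hBe hba hbe hBa).2 h4
      · rintro ⟨B, c⟩ h
        simp only [mul_assoc, swap_mul_self, mul_one]
      · rintro ⟨b, B, c⟩ h
        simp only [X, coe_filter, mem_filter, mem_univ, true_and, Set.mem_ofPred_eq,
          mem_erase] at h ⊢
        obtain ⟨⟨⟨hba, hbT⟩, hcT, h3, h4⟩, hcb⟩ := h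
        have hBe : B e = e := h3.1 e (by simp [heT])
        have : (B * swap b e)⁻¹ e = b := by
          rw [Perm.inv_eq_iff_eq]; simp [hBe]
        simp only [this, mul_assoc, swap_mul_self, mul_one]
    rw [← card_filter_add_card_filter_not (fun q : Perm α × α => q.2 = e), hp1, hp2, ← hX1,
      card_filter_add_card_filter_not, hX]
end helpers

section bridge
variable {α : Type*} [DecidableEq α] [Fintype α]

/-- The number of classes of the same-cycle relation. -/
def numCyc (σ : Perm α) : ℕ := Nat.card (Quotient (Perm.SameCycle.setoid σ))

theorem sc_fixed {σ : Perm α} {x y : α} (hx : σ x = x) (h : σ.SameCycle x y) : x = y := by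
  obtain ⟨i, hi⟩ := h
  rwa [Perm.zpow_apply_eq_self_of_apply_eq_self hx] at hi

theorem numCyc_insert {B : Perm α} {a b : α} (hb : B b = b) (hab : a ≠ b) :
    numCyc B = numCyc (B * swap a b) + 1 := by
  have hp : ∀ z, (if z = b then a else z) ≠ b := by
    intro z; split_ifs with h
    · exact hab
    · exact h
  let F : Option (Quotient (Perm.SameCycle.setoid (B * swap a b))) →
      Quotient (Perm.SameCycle.setoid B) := fun o => o.elim (Quotient.mk _ b)
    (Quotient.lift (fun z => Quotient.mk _ (if z = b then a else z))
      (fun z z' h => Quotient.sound ((sameCycle_insert hb hab z z').1 h)))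
  have hF : Function.Bijective F := by
    constructor
    · rintro (_ | q) (_ | q') h
      · rfl
      · induction q' using Quotient.inductionOn with | _ z =>
        have h' : B.SameCycle b (if z = b then a else z) := Quotient.exact h
        exact absurd (sc_fixed hb h').symm (hp z)
      · induction q using Quotient.inductionOn with | _ z =>
        have h' : B.SameCycle (if z = b then a else z) b := Quotient.exact h
        exact absurd (sc_fixed hb h'.symm).symm (hp z)
      · induction q using Quotient.inductionOn with | _ z =>
        induction q' using Quotient.inductionOn with | _ z' =>
        have h' : B.SameCycle (if z = b then a else z) (if z' = b then a else z') :=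
          Quotient.exact h
        exact congrArg some (Quotient.sound ((sameCycle_insert hb hab z z').2 h'))
    · intro q
      induction q using Quotient.inductionOn with | _ z =>
      by_cases hz : z = b
      · exact ⟨none, by rw [hz]; rfl⟩
      · refine ⟨some (Quotient.mk _ z), ?_⟩
        change Quotient.mk _ (if z = b then a else z) = _
        rw [if_neg hz]
  rw [numCyc, numCyc, ← Nat.card_eq_of_bijective F hF, Finite.card_option]

theorem numCyc_eq (σ : Perm α) :
    σ.cycleType.card + (univ.filter fun x => σ x = x).card = numCyc σ := by
  have hne : ∀ c : σ.cycleFactorsFinset, ∃ z, z ∈ c.1.support := by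
    intro c
    have := (Perm.mem_cycleFactorsFinset_iff.1 c.2).1.nonempty_support
    exact this
  choose g hg using hne
  have hgs : ∀ c, g c ∈ σ.support := fun c => Perm.mem_cycleFactorsFinset_support_le c.2 (hg c)
  have hgc : ∀ c, c.1 = σ.cycleOf (g c) := fun c => Perm.cycle_is_cycleOf (hg c) c.2
  let F : {x // x ∈ univ.filter fun x => σ x = x} ⊕ σ.cycleFactorsFinset →
      Quotient (Perm.SameCycle.setoid σ) :=
    Sum.elim (fun x => Quotient.mk _ x.1) (fun c => Quotient.mk _ (g c))
  have hF : Function.Bijective F := by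
    constructor
    · rintro (x | c) (y | d) h
      · have h' : σ.SameCycle x.1 y.1 := Quotient.exact h
        have hx : σ x.1 = x.1 := (mem_filter.1 x.2).2
        exact congrArg Sum.inl (Subtype.ext (sc_fixed hx h'))
      · have h' : σ.SameCycle x.1 (g d) := Quotient.exact h
        have hx : σ x.1 = x.1 := (mem_filter.1 x.2).2
        have := hgs d
        rw [← sc_fixed hx h', Perm.mem_support] at this
        exact absurd hx this
      · have h' : σ.SameCycle (g c) y.1 := Quotient.exact h
        have hx : σ y.1 = y.1 := (mem_filter.1 y.2).2
        have := hgs c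
        rw [← sc_fixed hx h'.symm, Perm.mem_support] at this
        exact absurd hx this
      · have h' : σ.SameCycle (g c) (g d) := Quotient.exact h
        refine congrArg Sum.inr (Subtype.ext ?_)
        rw [hgc c, hgc d]
        exact h'.cycleOf_eq
    · intro q
      induction q using Quotient.inductionOn with | _ z =>
      by_cases hz : σ z = z
      · exact ⟨Sum.inl ⟨z, by simpa using hz⟩, rfl⟩
      · have hm : σ.cycleOf z ∈ σ.cycleFactorsFinset :=
          Perm.cycleOf_mem_cycleFactorsFinset_iff.2 (Perm.mem_support.2 hz)
        refine ⟨Sum.inr ⟨_, hm⟩, ?_⟩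
        apply Quotient.sound
        have := hg ⟨_, hm⟩
        exact (Perm.mem_support_cycleOf_iff.1 this).1.symm
  rw [numCyc, ← Nat.card_eq_of_bijective F hF, Nat.card_sum]
  rw [Nat.card_eq_fintype_card, Nat.card_eq_fintype_card, Fintype.card_coe, Fintype.card_coe,
    Perm.cycleType_def, Multiset.card_map, add_comm]
  rfl

def SepOn (M : Finset α) (σ : Perm α) : Prop :=
  ∀ i ∈ M, ∀ j ∈ M, i ≠ j → ¬ σ.SameCycle i j

theorem sepOn_insert {M : Finset α} {σ : Perm α} {f y : α} (hf : σ f = f) (hy : y ≠ f) :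
    SepOn M (σ * swap y f) ↔
      (f ∈ M → y ∉ M) ∧ SepOn (if f ∈ M then insert y (M.erase f) else M) σ := by
  unfold SepOn
  simp only [sameCycle_insert hf hy]
  by_cases hfM : f ∈ M
  · simp only [hfM, if_true, true_imp_iff, mem_insert, mem_erase]
    constructor
    · intro h
      refine ⟨fun hyM => ?_, ?_⟩
      · refine h y hyM f hfM hy ?_
        simp only [if_neg hy, if_true]; exact Perm.SameCycle.refl _ _
      · rintro i (rfl | ⟨hi, hiM⟩) j (rfl | ⟨hj, hjM⟩) hij
        · exact absurd rfl hij
        · have := h f hfM j hjM (Ne.symm hj)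
          simpa only [if_neg hj, if_true] using this
        · have := h i hiM f hfM hi
          simpa only [if_neg hi, if_true] using this
        · have := h i hiM j hjM hij
          simpa only [if_neg hi, if_neg hj] using this
    · rintro ⟨h1, h2⟩ i hi j hj hij
      split_ifs with hif hjf hjf
      · exact absurd (hif.trans hjf.symm) hij
      · exact h2 y (Or.inl rfl) j (Or.inr ⟨hjf, hj⟩) (fun h => h1 (h ▸ hj))
      · exact h2 i (Or.inr ⟨hif, hi⟩) y (Or.inl rfl) (fun h => h1 (h ▸ hi))
      · exact h2 i (Or.inr ⟨hif, hi⟩) j (Or.inr ⟨hjf, hj⟩) hij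
  · simp only [hfM, if_false, false_imp_iff, true_and]
    constructor <;> intro h i hi j hj hij <;> have := h i hi j hj hij
    · rwa [if_neg (ne_of_mem_of_not_mem hi hfM), if_neg (ne_of_mem_of_not_mem hj hfM)] at this
    · rwa [if_neg (ne_of_mem_of_not_mem hi hfM), if_neg (ne_of_mem_of_not_mem hj hfM)]
end bridge

theorem cycleCount_eq {n : ℕ} (σ : Perm (Fin n)) : cycleCount σ = numCyc σ := numCyc_eq σ

theorem isFullCycle_iff {n : ℕ} (hn : 1 ≤ n) (σ : Perm (Fin n)) :
    IsFullCycle σ ↔ ∀ x y, σ.SameCycle x y := by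
  rw [IsFullCycle, cycleCount_eq, numCyc, Nat.card_eq_one_iff_unique]
  constructor
  · rintro ⟨h, -⟩ x y
    have : (Quotient.mk (Perm.SameCycle.setoid σ) x) = Quotient.mk _ y := Subsingleton.elim _ _
    exact Quotient.exact this
  · intro h
    refine ⟨⟨fun p q => ?_⟩, ⟨Quotient.mk _ ⟨0, hn⟩⟩⟩
    induction p using Quotient.inductionOn
    induction q using Quotient.inductionOn
    exact Quotient.sound (h _ _)

theorem sign_cycleCount {n : ℕ} (σ : Perm (Fin n)) :
    Perm.sign σ = (-1) ^ (n + cycleCount σ) := by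
  have h1 : (univ.filter fun x => σ x = x).card + σ.support.card = n := by
    have := card_filter_add_card_filter_not (s := (univ : Finset (Fin n))) (fun x => σ x = x)
    simp only [card_univ, Fintype.card_fin] at this
    exact this
  rw [Perm.sign_of_cycleType, Perm.sum_cycleType, cycleCount]
  have : n + (σ.cycleType.card + (univ.filter fun x => σ x = x).card) =
    (σ.support.card + σ.cycleType.card) + 2 * (univ.filter fun x => σ x = x).card := by omega
  rw [this, pow_add _ _ (2 * _), pow_mul]
  simp

theorem exists_good_equiv {n m : ℕ} (hm : m ≤ n) (f : Fin (n + 1)) (M : Finset (Fin (n + 1)))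
    (hf : f ∉ M) (hM : M.card = m) :
    ∃ e : Fin n ≃ {x // x ≠ f}, ∀ i : Fin n, (i : ℕ) < m ↔ (e i).1 ∈ M := by
  have e0 : Fin n ≃ {x // x ≠ f} := Fintype.equivOfCardEq (by
    rw [Fintype.card_subtype_compl]; simp)
  have hc1 : Fintype.card {i : Fin n // (i : ℕ) < m} = m := by
    rw [Fintype.card_subtype]
    rw [Fin.card_filter_val_lt]; exact min_eq_right hm
  have hc2 : Fintype.card {i : Fin n // (e0 i).1 ∈ M} = m := by
    rw [← hM, ← Fintype.card_coe]
    apply Fintype.card_congr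
    exact {
      toFun := fun i => ⟨(e0 i.1).1, i.2⟩
      invFun := fun x => ⟨e0.symm ⟨x.1, fun h => hf (h ▸ x.2)⟩, by simp⟩
      left_inv := fun i => by simp
      right_inv := fun x => by simp }
  have e1 : {i : Fin n // (i : ℕ) < m} ≃ {i : Fin n // (e0 i).1 ∈ M} :=
    Fintype.equivOfCardEq (hc1.trans hc2.symm)
  refine ⟨e1.extendSubtype.trans e0, fun i => ?_⟩
  constructor
  · intro hi
    exact e1.extendSubtype_mem i hi
  · intro hi
    by_contra hc
    exact e1.extendSubtype_not_mem i hc hi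

theorem cycleCount_extend {n : ℕ} {f : Fin (n + 1)} (e : Fin n ≃ {x // x ≠ f})
    (σ : Perm (Fin n)) : cycleCount (σ.extendDomain e) = cycleCount σ + 1 := by
  have h1 : ∀ {n : ℕ} (σ : Perm (Fin n)),
      (univ.filter fun x => σ x = x).card + σ.support.card = n := by
    intro n σ
    have := card_filter_add_card_filter_not (s := (univ : Finset (Fin n))) (fun x => σ x = x)
    simp only [card_univ, Fintype.card_fin] at this
    exact this
  have h2 := h1 σ
  have h3 := h1 (σ.extendDomain e)
  rw [← Perm.sum_cycleType] at h2 h3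
  rw [Perm.cycleType_extendDomain] at h3
  unfold cycleCount
  rw [Perm.cycleType_extendDomain]
  omega

theorem extend_fix {n : ℕ} {f : Fin (n + 1)} (e : Fin n ≃ {x // x ≠ f})
    (σ : Perm (Fin n)) : σ.extendDomain e f = f :=
  Perm.extendDomain_apply_not_subtype _ _ (by simp)

theorem fullOn_extend {n : ℕ} (hn : 1 ≤ n) {f : Fin (n + 1)} (e : Fin n ≃ {x // x ≠ f})
    (σ : Perm (Fin n)) : FullOn (univ.erase f) (σ.extendDomain e) ↔ IsFullCycle σ := by
  rw [isFullCycle_iff hn]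
  constructor
  · rintro ⟨-, h⟩ x y
    exact Perm.sameCycle_extendDomain.1 (h (e x) (by simp [(e x).2]) (e y) (by simp [(e y).2]))
  · intro h
    refine ⟨fun x hx => ?_, fun x hx y hy => ?_⟩
    · have : x = f := by simpa using hx
      rw [this, extend_fix]
    · have hx' : x ≠ f := by simpa using hx
      have hy' : y ≠ f := by simpa using hy
      have := Perm.sameCycle_extendDomain (f := e) |>.2 (h (e.symm ⟨x, hx'⟩) (e.symm ⟨y, hy'⟩))
      simpa using this

theorem sepOn_extend {n m : ℕ} {f : Fin (n + 1)} (e : Fin n ≃ {x // x ≠ f})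
    {M : Finset (Fin (n + 1))} (hf : f ∉ M) (he : ∀ i : Fin n, (i : ℕ) < m ↔ (e i).1 ∈ M)
    (σ : Perm (Fin n)) : SepOn M (σ.extendDomain e) ↔ Separates m σ := by
  constructor
  · intro h i j hi hj hij hs
    refine h (e i) ((he i).1 hi) (e j) ((he j).1 hj) ?_ (Perm.sameCycle_extendDomain.2 hs)
    intro h; exact hij (e.injective (Subtype.ext h))
  · intro h i hi j hj hij hs
    have hi' : i ≠ f := ne_of_mem_of_not_mem hi hf
    have hj' : j ≠ f := ne_of_mem_of_not_mem hj hf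
    refine h (e.symm ⟨i, hi'⟩) (e.symm ⟨j, hj'⟩) ((he _).2 (by simpa using hi))
      ((he _).2 (by simpa using hj)) (by simpa using hij) ?_
    apply Perm.sameCycle_extendDomain (f := e) |>.1
    simpa using hs

theorem exists_extend {n : ℕ} {f : Fin (n + 1)} (e : Fin n ≃ {x // x ≠ f})
    (τ : Perm (Fin (n + 1))) (hτ : τ f = f) : ∃ σ : Perm (Fin n), σ.extendDomain e = τ := by
  have hτ' : ∀ x, x ≠ f ↔ τ x ≠ f := by
    intro x
    constructor
    · intro h h'
      exact h (τ.injective (h'.trans hτ.symm))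
    · rintro h rfl
      exact h hτ
  refine ⟨e.symm.permCongr (τ.subtypePerm (fun x => (hτ' x).symm)), ?_⟩
  ext x
  by_cases hx : x = f
  · rw [hx, extend_fix, hτ]
  · rw [Perm.extendDomain_apply_subtype (p := fun x => x ≠ f) _ e hx]
    simp [Equiv.permCongr_apply]

open Classical in
theorem transport_count {n m k : ℕ} (hn : 1 ≤ n) (hm : m ≤ n) (f : Fin (n + 1))
    (M : Finset (Fin (n + 1))) (hf : f ∉ M) (hM : M.card = m) :
    ((univ : Finset (Perm (Fin (n + 1)) × Perm (Fin (n + 1)))).filter fun p =>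
      FullOn (univ.erase f) p.1 ∧ FullOn (univ.erase f) p.2 ∧
      cycleCount (p.1 * p.2) = k + 1 ∧ SepOn M (p.1 * p.2)).card =
    Nat.card {p : Equiv.Perm (Fin n) × Equiv.Perm (Fin n) //
        IsFullCycle p.1 ∧ IsFullCycle p.2 ∧
        cycleCount (p.1 * p.2) = k ∧ Separates m (p.1 * p.2)} := by
  obtain ⟨e, he⟩ := exists_good_equiv hm f M hf hM
  rw [Nat.card_eq_fintype_card, Fintype.card_subtype]
  symm
  refine card_bij (fun p _ => (p.1.extendDomain e, p.2.extendDomain e)) ?_ ?_ ?_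
  · rintro ⟨u, v⟩ h
    simp only [mem_filter, mem_univ, true_and] at h ⊢
    rw [Perm.extendDomain_mul, fullOn_extend hn, fullOn_extend hn, cycleCount_extend,
      sepOn_extend e hf he]
    exact ⟨h.1, h.2.1, by rw [h.2.2.1], h.2.2.2⟩
  · rintro ⟨u, v⟩ _ ⟨u', v'⟩ _ h
    simp only [Prod.mk.injEq] at h
    have h1 := Perm.extendDomainHom_injective (p := fun x => x ≠ f) e h.1
    have h2 := Perm.extendDomainHom_injective (p := fun x => x ≠ f) e h.2
    rw [h1, h2]
  · rintro ⟨u, v⟩ h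
    simp only [mem_filter, mem_univ, true_and] at h
    obtain ⟨u, rfl⟩ := exists_extend e u (h.1.1 f (by simp))
    obtain ⟨v, rfl⟩ := exists_extend e v (h.2.1.1 f (by simp))
    rw [Perm.extendDomain_mul, fullOn_extend hn, fullOn_extend hn, cycleCount_extend,
      sepOn_extend e hf he] at h
    refine ⟨(u, v), ?_, rfl⟩
    simp only [mem_filter, mem_univ, true_and]
    exact ⟨h.1, h.2.1, by omega, h.2.2.2⟩

/-- For `n ≥ 1`, `m ≤ n`, `1 ≤ k ≤ n` with `n - k` even, the number of
ordered pairs `(u, v)` of `n`-cycles on `[n]` whose product `u ∘ v` has exactly `k` cycles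
and separates `[m]` equals `2 (n-1)! C_m(n+1, k) / ((n+m)(n+1-m))`; equivalently,
`(n+m)(n+1-m)` times this number equals `2 (n-1)! C_m(n+1, k)`. -/
theorem separated_pair_count (n m k : ℕ) (hn : 1 ≤ n) (hm : m ≤ n)
    (hk1 : 1 ≤ k) (hkn : k ≤ n) (hpar : Even (n - k)) :
    (n + m) * (n + 1 - m) *
      Nat.card {p : Equiv.Perm (Fin n) × Equiv.Perm (Fin n) //
        IsFullCycle p.1 ∧ IsFullCycle p.2 ∧
        cycleCount (p.1 * p.2) = k ∧ Separates m (p.1 * p.2)} =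
    2 * Nat.factorial (n - 1) * sepCount (n + 1) m k := by
  classical
  obtain ⟨L, hL⟩ : ∃ L, L = Nat.card {p : Equiv.Perm (Fin n) × Equiv.Perm (Fin n) //
        IsFullCycle p.1 ∧ IsFullCycle p.2 ∧
        cycleCount (p.1 * p.2) = k ∧ Separates m (p.1 * p.2)} := ⟨_, rfl⟩
  rw [← hL]
  obtain ⟨M, hM⟩ : ∃ M : Finset (Fin (n + 1)), M = univ.filter (fun i : Fin (n + 1) => (i : ℕ) < m) := ⟨_, rfl⟩
  have hMc : M.card = m := by
    rw [hM, Fin.card_filter_val_lt]; omega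
  have hsep : ∀ w : Perm (Fin (n + 1)), Separates m w ↔ SepOn M w := by
    intro w
    simp only [Separates, SepOn, hM, mem_filter, mem_univ, true_and]
    exact ⟨fun h i hi j hj => h i j hi hj, fun h i j hi hj => h i hi j hj⟩
  let R : Finset (Perm (Fin (n + 1)) × (Perm (Fin (n + 1)) × Fin (n + 1))) :=
    univ.filter fun q => (cycleCount q.1 = k ∧ SepOn M q.1) ∧
      (FullOn (univ.erase q.2.2) q.2.1 ∧ FullOn univ (q.1 * q.2.1⁻¹))
  have hR : R.card = 2 * Nat.factorial (n - 1) * sepCount (n + 1) m k := by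
    rw [sepCount, Nat.card_eq_fintype_card, Fintype.card_subtype, card_filter,
      Fintype.sum_prod_type, card_filter, mul_sum]
    refine sum_congr rfl fun w _ => ?_
    by_cases hw : cycleCount w = k ∧ SepOn M w
    · have := pairs_count (n - 1) (univ : Finset (Fin (n + 1)))
        (by simp; omega) w (fun x hx => absurd (mem_univ x) hx) (by
          rw [sign_cycleCount, hw.1]
          apply Odd.neg_one_pow
          obtain ⟨r, hr⟩ := hpar
          exact ⟨k + r, by omega⟩)
      rw [card_filter] at this
      simp only [mem_univ, true_and] at this
      simp only [hsep, hw, true_and, and_self, if_true, mul_one]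
      exact this
    · simp only [hsep, hw, false_and, if_false, sum_const_zero, mul_zero]
  let G : Fin (n + 1) → Finset (Fin (n + 1)) := fun f => if f ∈ M then Mᶜ else univ.erase f
  let M' : Fin (n + 1) → Fin (n + 1) → Finset (Fin (n + 1)) := fun f y =>
    if f ∈ M then insert y (M.erase f) else M
  have hG : ∀ f y, y ∈ G f ↔ (y ≠ f ∧ (f ∈ M → y ∉ M)) := by
    intro f y
    by_cases hf : f ∈ M
    · simp only [G, hf, if_true, mem_compl, true_imp_iff]
      exact ⟨fun h => ⟨fun h' => h (h' ▸ hf), h⟩, fun h => h.2⟩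
    · simp [G, hf]
  let H : Finset ((Fin (n + 1) × Fin (n + 1)) × (Perm (Fin (n + 1)) × Perm (Fin (n + 1)))) :=
    univ.filter fun q => q.1.2 ∈ G q.1.1 ∧
      (FullOn (univ.erase q.1.1) q.2.1 ∧ FullOn (univ.erase q.1.1) q.2.2 ∧
      cycleCount (q.2.1 * q.2.2) = k + 1 ∧ SepOn (M' q.1.1 q.1.2) (q.2.1 * q.2.2))
  have hH : H.card = (n + m) * (n + 1 - m) * L := by
    have hin : ∀ f y, (∑ p : Perm (Fin (n + 1)) × Perm (Fin (n + 1)),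
        if (y ∈ G f ∧ (FullOn (univ.erase f) p.1 ∧ FullOn (univ.erase f) p.2 ∧
      cycleCount (p.1 * p.2) = k + 1 ∧ SepOn (M' f y) (p.1 * p.2))) then 1 else 0) =
        if y ∈ G f then L else 0 := by
      intro f y
      by_cases hy : y ∈ G f
      · simp only [hy, true_and, if_true]
        rw [hL, ← card_filter]
        have hy' := (hG f y).1 hy
        apply transport_count hn hm
        · by_cases hf : f ∈ M
          · simp [M', hf, Ne.symm hy'.1]
          · simp [M', hf]
        · by_cases hf : f ∈ M
          · simp only [M', hf, if_true]
            rw [card_insert_of_notMem (by simp [hy'.2 hf]), card_erase_of_mem hf, hMc]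
            have : 0 < M.card := card_pos.2 ⟨f, hf⟩
            omega
          · simp [M', hf, hMc]
      · simp [hy]
    rw [card_filter, Fintype.sum_prod_type, Fintype.sum_prod_type]
    simp only [hin]
    have h2 : ∀ f, (∑ y, if y ∈ G f then L else 0) = (if f ∈ M then (n + 1 - m) else n) * L := by
      intro f
      rw [← sum_filter, sum_const, smul_eq_mul]
      congr 1
      rw [filter_mem_eq_inter, univ_inter]
      by_cases hf : f ∈ M
      · simp [G, hf, card_compl, hMc]
      · simp [G, hf]
    simp only [h2]
    rw [← sum_mul, sum_ite, sum_const, sum_const]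
    have h3 : (univ.filter fun f => f ∈ M).card = m := by
      rw [filter_mem_eq_inter, univ_inter, hMc]
    have h4 : (univ.filter fun f => f ∉ M).card = n + 1 - m := by
      have := card_filter_add_card_filter_not (s := (univ : Finset (Fin (n + 1)))) (fun f => f ∈ M)
      rw [h3] at this
      simp only [card_univ, Fintype.card_fin] at this
      omega
    rw [h3, h4, smul_eq_mul, smul_eq_mul]
    ring
  rw [← hH, ← hR]
  -- the equivalences behind the bijection
  have hcore : ∀ (r B : Perm (Fin (n + 1))) (f y : Fin (n + 1)), y ≠ f → r f = f →
      FullOn (univ.erase f) B →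
      (((cycleCount (r * swap y f) = k ∧ SepOn M (r * swap y f)) ∧
        FullOn univ (r * swap y f * B⁻¹)) ↔
      (y ∈ G f ∧ FullOn (univ.erase f) (r * B⁻¹) ∧ cycleCount r = k + 1 ∧
        SepOn (M' f y) r)) := by
    intro r B f y hy hr hB
    have hBf : B f = f := hB.1 f (by simp)
    have h1 : cycleCount (r * swap y f) = k ↔ cycleCount r = k + 1 := by
      rw [cycleCount_eq, cycleCount_eq, numCyc_insert hr hy]; omega
    have h2 : FullOn univ (r * swap y f * B⁻¹) ↔ FullOn (univ.erase f) (r * B⁻¹) := by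
      have h := Equiv.swap_mul_eq_mul_swap B⁻¹ y f
      rw [inv_inv, hBf] at h
      have hByf : B y ≠ f := fun h => hy (B.injective (h.trans hBf.symm))
      rw [mul_assoc, h, ← mul_assoc, ← insert_erase (mem_univ f),
        fullOn_insert (by simp) (by simp [hByf]), insert_erase (mem_univ f)]
      rw [Perm.mul_apply, hB.inv.1 f (by simp), hr]
    rw [h1, h2, sepOn_insert hr hy, hG]
    simp only [M']
    tauto
  refine (card_nbij' (fun q => ((q.2.2, q.1⁻¹ q.2.2),
    (q.1 * swap (q.1⁻¹ q.2.2) q.2.2 * q.2.1⁻¹, q.2.1)))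
    (fun q => (q.2.1 * q.2.2 * swap q.1.2 q.1.1, (q.2.2, q.1.1))) ?_ ?_ ?_ ?_).symm
  · rintro ⟨w, B, f⟩ h
    simp only [R, H, coe_filter, mem_univ, true_and, Set.mem_ofPred_eq] at h ⊢
    obtain ⟨h1, h2, h3⟩ := h
    obtain ⟨y, hy⟩ : ∃ y, w y = f := w.surjective f
    have hyi : w⁻¹ f = y := by rw [Perm.inv_eq_iff_eq, hy]
    rw [hyi]
    have hBf : B f = f := h2.1 f (by simp)
    have hyf : y ≠ f := by
      rintro rfl
      obtain ⟨x, -, hx⟩ := (univ : Finset (Fin (n + 1))).exists_mem_ne (by simp; omega) y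
      have := h3.2 y (mem_univ _) x (mem_univ _)
      refine hx (sc_fixed ?_ this).symm
      rw [Perm.mul_apply, h2.inv.1 y (by simp), hy]
    obtain ⟨r, hr⟩ : ∃ r : Perm (Fin (n + 1)), r = w * swap y f := ⟨_, rfl⟩
    have hwr : w = r * swap y f := by rw [hr, mul_assoc, swap_mul_self, mul_one]
    have hrf : r f = f := by rw [hr]; simp [hy]
    rw [← hr, inv_mul_cancel_right]
    rw [hwr] at h1 h3
    have := (hcore r B f y hyf hrf h2).1 ⟨h1, h3⟩
    exact ⟨this.1, this.2.1, h2, this.2.2⟩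
  · rintro ⟨⟨f, y⟩, u, v⟩ h
    simp only [R, H, coe_filter, mem_univ, true_and, Set.mem_ofPred_eq] at h ⊢
    obtain ⟨h1, h2, h3, h4⟩ := h
    have hyf := ((hG f y).1 h1).1
    have hrf : (u * v) f = f := by
      rw [Perm.mul_apply, h3.1 f (by simp), h2.1 f (by simp)]
    have := (hcore (u * v) v f y hyf hrf h3).2 ⟨h1, by rwa [mul_inv_cancel_right], h4⟩
    exact ⟨this.1, h3, this.2⟩
  · rintro ⟨w, B, f⟩ h
    simp only [inv_mul_cancel_right]
    rw [mul_assoc w, swap_mul_self, mul_one]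
  · rintro ⟨⟨f, y⟩, u, v⟩ h
    simp only [H, coe_filter, mem_univ, true_and, Set.mem_ofPred_eq] at h ⊢
    obtain ⟨h1, h2, h3, h4⟩ := h
    have : (u * v * swap y f)⁻¹ f = y := by
      rw [Perm.inv_eq_iff_eq]; simp [h3.1 f (by simp), h2.1 f (by simp)]
    rw [this, mul_assoc (u * v), swap_mul_self, mul_one, mul_inv_cancel_right]
end
end

section
/- Let n ≥ 1 and 0 ≤ m < n, and let k be an integer with m ≤ k ≤ n such that n − k is even. Then the number of ordered pairs (u, v) of n-cycles on [n] such that the product u∘v has exactly k cycles and u∘v fixes every element of [m] equals 2·(n−1)!·C(n+1−m, k−m) / ((n−m)(n+1−m)); equivalently, (n−m)(n+1−m) times this number of pairs equals 2·(n−1)!·C(n+1−m, k−m). -/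
open Equiv Finset

noncomputable section

/-- Cycle count over a general finite type. -/
def cyc {α : Type*} [Fintype α] [DecidableEq α] (σ : Equiv.Perm α) : ℕ :=
  σ.cycleType.card + (Finset.univ.filter fun x => σ x = x).card

theorem cycleCount_eq_cyc {n : ℕ} (σ : Equiv.Perm (Fin n)) : cycleCount σ = cyc σ := rfl

section general
variable {α : Type*} [Fintype α] [DecidableEq α]

theorem cyc_add_sum (σ : Equiv.Perm α) :
    cyc σ + σ.cycleType.sum = σ.cycleType.card + Fintype.card α := by
  have h : (Finset.univ.filter fun x => σ x = x).card + σ.support.card = Fintype.card α := by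
    have := Finset.card_filter_add_card_filter_not (s := (Finset.univ : Finset α)) (fun x => σ x = x)
    rw [Finset.card_univ] at this
    rw [← this]
    congr 1
  rw [Equiv.Perm.sum_cycleType]
  unfold cyc
  omega

theorem sign_eq_cyc (σ : Equiv.Perm α) :
    ((Equiv.Perm.sign σ : ℤˣ) : ℤ) = (-1) ^ (Fintype.card α + cyc σ) := by
  rw [Equiv.Perm.sign_of_cycleType]
  have h := cyc_add_sum σ
  push_cast
  have : Even (σ.cycleType.sum + σ.cycleType.card + (Fintype.card α + cyc σ)) := by
    refine ⟨σ.cycleType.card + Fintype.card α, by omega⟩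
  exact neg_one_pow_congr (Nat.even_add.1 this)

theorem cyc_inv (σ : Equiv.Perm α) : cyc σ⁻¹ = cyc σ := by
  have h1 := cyc_add_sum σ
  have h2 := cyc_add_sum σ⁻¹
  rw [Equiv.Perm.cycleType_inv] at h2
  omega

theorem cyc_conj (σ τ : Equiv.Perm α) : cyc (τ * σ * τ⁻¹) = cyc σ := by
  have h1 := cyc_add_sum σ
  have h2 := cyc_add_sum (τ * σ * τ⁻¹)
  rw [Equiv.Perm.cycleType_conj] at h2
  omega

/-- a labelling function of cycles -/
def lab (σ : Equiv.Perm α) (x : α) : Equiv.Perm α ⊕ α :=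
  if σ x = x then Sum.inr x else Sum.inl (σ.cycleOf x)

theorem lab_eq_iff (σ : Equiv.Perm α) (x y : α) : lab σ x = lab σ y ↔ σ.SameCycle x y := by
  unfold lab
  by_cases hx : σ x = x
  · by_cases hy : σ y = y
    · simp only [hx, hy, if_true, Sum.inr.injEq]
      constructor
      · rintro rfl; rfl
      · intro h; exact (h.eq_of_left hx)
    · simp only [hx, hy, if_true, if_false, reduceCtorEq, false_iff]
      intro h
      exact hy ((h.apply_eq_self_iff).1 hx)
  · by_cases hy : σ y = y
    · simp only [hx, hy, if_true, if_false, reduceCtorEq, false_iff]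
      intro h
      exact hx ((h.apply_eq_self_iff).2 hy)
    · simp only [hx, hy, if_false, Sum.inl.injEq]
      exact (Equiv.Perm.sameCycle_iff_cycleOf_eq_of_mem_support
        (Equiv.Perm.mem_support.2 hx) (Equiv.Perm.mem_support.2 hy)).symm

theorem card_image_lab (σ : Equiv.Perm α) : (Finset.univ.image (lab σ)).card = cyc σ := by
  have : Finset.univ.image (lab σ) =
      (σ.cycleFactorsFinset).disjSum (Finset.univ.filter fun x => σ x = x) := by
    ext z
    rcases z with c | x
    · simp only [Finset.mem_image, Finset.mem_univ, true_and, Finset.inl_mem_disjSum]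
      constructor
      · rintro ⟨x, hx⟩
        unfold lab at hx
        split_ifs at hx with h
        simp only [Sum.inl.injEq] at hx
        rw [← hx]
        exact Equiv.Perm.cycleOf_mem_cycleFactorsFinset_iff.2 (Equiv.Perm.mem_support.2 h)
      · intro hc
        have hcyc := (Equiv.Perm.mem_cycleFactorsFinset_iff.1 hc)
        obtain ⟨x, hx⟩ := hcyc.1.nonempty_support
        refine ⟨x, ?_⟩
        have h2 := Equiv.Perm.cycle_is_cycleOf hx hc
        have h3 := Equiv.Perm.mem_cycleFactorsFinset_support_le hc hx
        unfold lab
        rw [if_neg (Equiv.Perm.mem_support.1 h3), ← h2]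
    · simp only [Finset.mem_image, Finset.mem_univ, true_and, Finset.inr_mem_disjSum,
        Finset.mem_filter]
      constructor
      · rintro ⟨y, hy⟩
        unfold lab at hy
        split_ifs at hy with h
        simp only [Sum.inr.injEq] at hy
        rw [← hy]; exact h
      · intro h
        exact ⟨x, by unfold lab; rw [if_pos h]⟩
  rw [this, Finset.card_disjSum]
  unfold cyc
  rw [Equiv.Perm.cycleType_def]
  simp

theorem card_image_le_of_ker {β γ : Type*} [DecidableEq β] [DecidableEq γ] (g : α → β) (h : α → γ)
    (hg : ∀ x y, g x = g y → h x = h y) :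
    (Finset.univ.image h).card ≤ (Finset.univ.image g).card := by
  rcases isEmpty_or_nonempty α with hα | hα
  · simp
  · have : Finset.univ.image h = (Finset.univ.image g).image
        (Function.extend g h (fun _ => h (Classical.arbitrary α))) := by
      rw [Finset.image_image]
      congr 1
      exact (Function.FactorsThrough.extend_comp (f := g) (g := h) _ (fun x y => hg x y)).symm
    rw [this]
    exact Finset.card_image_le

theorem card_image_of_ker {β : Type*} [DecidableEq β] (σ : Equiv.Perm α) (g : α → β)
    (hg : ∀ x y, g x = g y ↔ σ.SameCycle x y) : (Finset.univ.image g).card = cyc σ := by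
  rw [← card_image_lab]
  have hk : ∀ x y, g x = g y ↔ lab σ x = lab σ y := fun x y => by rw [hg, lab_eq_iff]
  exact le_antisymm (card_image_le_of_ker _ _ fun x y => (hk x y).2)
    (card_image_le_of_ker _ _ fun x y => (hk x y).1)

theorem cyc_eq_one_iff [Nonempty α] (σ : Equiv.Perm α) :
    cyc σ = 1 ↔ ∀ x y, σ.SameCycle x y := by
  rw [← card_image_lab, Finset.card_eq_one]
  constructor
  · rintro ⟨c, hc⟩ x y
    rw [← lab_eq_iff]
    have hx : lab σ x ∈ ({c} : Finset _) := hc ▸ Finset.mem_image_of_mem _ (Finset.mem_univ x)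
    have hy : lab σ y ∈ ({c} : Finset _) := hc ▸ Finset.mem_image_of_mem _ (Finset.mem_univ y)
    rw [Finset.mem_singleton] at hx hy
    rw [hx, hy]
  · intro h
    refine ⟨lab σ (Classical.arbitrary α), ?_⟩
    ext z
    simp only [Finset.mem_image, Finset.mem_univ, true_and, Finset.mem_singleton]
    constructor
    · rintro ⟨y, rfl⟩
      exact (lab_eq_iff _ _ _).2 (h _ _)
    · rintro rfl
      exact ⟨_, rfl⟩

theorem sameCycle_swap_mul (σ : Equiv.Perm α) (a b : α) (hab : ¬ σ.SameCycle a b) :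
    (Equiv.swap a b * σ).SameCycle a b := by
  classical
  -- least positive return time of a
  have hex : ∃ k, 0 < k ∧ (σ ^ k) a = a := ⟨orderOf σ, orderOf_pos σ, by rw [pow_orderOf_eq_one]; rfl⟩
  have hk := Nat.find_spec hex
  have hmin := fun m => Nat.find_min (m := m) hex
  set k := Nat.find hex with hkdef
  have key : ∀ j, j < k → ((Equiv.swap a b * σ) ^ j) a = (σ ^ j) a := by
    intro j
    induction j with
    | zero => intro _; rfl
    | succ j ih =>
      intro hj
      rw [pow_succ', Equiv.Perm.mul_apply, ih (by omega), Equiv.Perm.mul_apply,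
        ← Equiv.Perm.mul_apply σ, ← pow_succ']
      apply Equiv.swap_apply_of_ne_of_ne
      · intro h
        exact hmin (j + 1) hj ⟨by omega, h⟩
      · intro h
        exact hab ⟨((j + 1 : ℕ) : ℤ), by rw [zpow_natCast]; exact h⟩
  refine ⟨(k : ℤ), ?_⟩
  rw [zpow_natCast]
  obtain ⟨k', hk'⟩ : ∃ k', k = k' + 1 := ⟨k - 1, by omega⟩
  rw [hk'] at hk
  rw [hk', pow_succ', Equiv.Perm.mul_apply, key k' (by omega), Equiv.Perm.mul_apply,
        ← Equiv.Perm.mul_apply σ, ← pow_succ', hk.2, Equiv.swap_apply_left]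

theorem sameCycle_imp_of_apply {β : Type*} (σ : Equiv.Perm α) (f : α → β) (hf : ∀ x, f (σ x) = f x)
    {x y : α} (h : σ.SameCycle x y) : f x = f y := by
  obtain ⟨k, _, hk⟩ := h.exists_pow_eq'
  rw [← hk]
  clear hk
  induction k with
  | zero => rfl
  | succ k ih =>
    rw [pow_succ', Equiv.Perm.mul_apply, hf]
    apply ih
    omega

theorem cyc_swap_mul (σ : Equiv.Perm α) (a b : α) (hab : ¬ σ.SameCycle a b) :
    cyc (Equiv.swap a b * σ) + 1 = cyc σ := by
  classical
  set σ' := Equiv.swap a b * σ with hσ'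
  have hab' : σ'.SameCycle a b := sameCycle_swap_mul σ a b hab
  let f' : α → Equiv.Perm α ⊕ α := fun x => if lab σ x = lab σ b then lab σ a else lab σ x
  have hne : lab σ a ≠ lab σ b := fun h => hab ((lab_eq_iff _ _ _).1 h)
  have hlab : ∀ x, lab σ (σ x) = lab σ x := fun x =>
    (lab_eq_iff _ _ _).2 (Equiv.Perm.sameCycle_apply_left.2 (Equiv.Perm.SameCycle.refl _ _))
  have hf'a : f' a = f' b := by simp [f']
  have hinv : ∀ x, f' (σ' x) = f' x := by
    intro x
    have h1 : ∀ y, f' (Equiv.swap a b y) = f' y := by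
      intro y
      rcases Equiv.swap_apply_eq_iff.1 (rfl : Equiv.swap a b y = Equiv.swap a b y) with _
      by_cases hya : y = a
      · rw [hya, Equiv.swap_apply_left, hf'a]
      · by_cases hyb : y = b
        · rw [hyb, Equiv.swap_apply_right, hf'a]
        · rw [Equiv.swap_apply_of_ne_of_ne hya hyb]
    rw [hσ', Equiv.Perm.mul_apply, h1]
    simp only [f', hlab]
  have hσσ' : ∀ x, σ'.SameCycle (σ x) x := by
    intro x
    have h0 : σ'.SameCycle (σ' x) x := Equiv.Perm.sameCycle_apply_left.2 (Equiv.Perm.SameCycle.refl _ _)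
    have h1 : ∀ y, σ'.SameCycle y (Equiv.swap a b y) := by
      intro y
      by_cases hya : y = a
      · rw [hya, Equiv.swap_apply_left]; exact hab'
      · by_cases hyb : y = b
        · rw [hyb, Equiv.swap_apply_right]; exact hab'.symm
        · rw [Equiv.swap_apply_of_ne_of_ne hya hyb]
    exact (h1 (σ x)).trans h0
  have hle : ∀ x y, σ.SameCycle x y → σ'.SameCycle x y := by
    intro x y h
    have := sameCycle_imp_of_apply σ (lab σ') (fun x => (lab_eq_iff _ _ _).2 (hσσ' x)) h
    exact (lab_eq_iff _ _ _).1 this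
  have hker : ∀ x y, f' x = f' y ↔ σ'.SameCycle x y := by
    intro x y
    constructor
    · intro h
      have : ∀ z, lab σ' z = lab σ' (if lab σ z = lab σ b then a else z) := by
        intro z
        split_ifs with hz
        · exact (lab_eq_iff _ _ _).2 ((hle _ _ ((lab_eq_iff _ _ _).1 hz)).trans hab'.symm)
        · rfl
      have h2 : ∀ z, f' z = lab σ (if lab σ z = lab σ b then a else z) := by
        intro z
        simp only [f']
        split_ifs <;> rfl
      rw [← lab_eq_iff, this x, this y]
      rw [h2, h2] at h
      exact (lab_eq_iff _ _ _).2 (hle _ _ ((lab_eq_iff _ _ _).1 h))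
    · exact fun h => sameCycle_imp_of_apply σ' f' hinv h
  rw [← card_image_of_ker σ' f' hker, ← card_image_lab]
  have : Finset.univ.image f' = (Finset.univ.image (lab σ)).erase (lab σ b) := by
    ext z
    simp only [Finset.mem_image, Finset.mem_univ, true_and, Finset.mem_erase]
    constructor
    · rintro ⟨x, rfl⟩
      simp only [f']
      split_ifs with h
      · exact ⟨hne, a, rfl⟩
      · exact ⟨h, x, rfl⟩
    · rintro ⟨h, x, rfl⟩
      exact ⟨x, by simp only [f']; rw [if_neg h]⟩
  rw [this, Finset.card_erase_of_mem (Finset.mem_image_of_mem _ (Finset.mem_univ b))]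
  have : 0 < (Finset.univ.image (lab σ)).card :=
    Finset.card_pos.2 ⟨_, Finset.mem_image_of_mem _ (Finset.mem_univ b)⟩
  omega

end general

section gen
open Polynomial

theorem cyc_extendDomain {α β : Type*} [Fintype α] [DecidableEq α] [Fintype β] [DecidableEq β]
    {p : β → Prop} [DecidablePred p] (f : α ≃ Subtype p) (σ : Equiv.Perm α) :
    cyc (σ.extendDomain f) + Fintype.card α = cyc σ + Fintype.card β := by
  have h1 := cyc_add_sum σ
  have h2 := cyc_add_sum (σ.extendDomain f)
  rw [Equiv.Perm.cycleType_extendDomain] at h2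
  omega

theorem decomposeFin_zero_eq {n : ℕ} (e : Equiv.Perm (Fin n)) :
    Equiv.Perm.decomposeFin.symm (0, e) =
      e.extendDomain (finSuccAboveEquiv (0 : Fin (n + 1))) := by
  ext i
  refine Fin.cases ?_ (fun j => ?_) i
  · rw [Equiv.Perm.decomposeFin_symm_apply_zero, Equiv.Perm.extendDomain_apply_not_subtype]
    simp
  · rw [Equiv.Perm.decomposeFin_symm_apply_succ, Equiv.swap_self]
    have := Equiv.Perm.extendDomain_apply_image e (finSuccAboveEquiv (0 : Fin (n + 1))) j
    simp [finSuccAboveEquiv_apply] at this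
    rw [this]
    simp

theorem decomposeFin_eq {n : ℕ} (p : Fin (n + 1)) (e : Equiv.Perm (Fin n)) :
    Equiv.Perm.decomposeFin.symm (p, e) =
      Equiv.swap 0 p * Equiv.Perm.decomposeFin.symm (0, e) := by
  ext i
  refine Fin.cases ?_ (fun j => ?_) i
  · rw [Equiv.Perm.mul_apply]; simp
  · rw [Equiv.Perm.mul_apply]; simp

theorem cyc_decomposeFin_zero {n : ℕ} (e : Equiv.Perm (Fin n)) :
    cyc (Equiv.Perm.decomposeFin.symm (0, e)) = cyc e + 1 := by
  rw [decomposeFin_zero_eq]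
  have := cyc_extendDomain (finSuccAboveEquiv (0 : Fin (n + 1))) e
  simp only [Fintype.card_fin] at this
  omega

theorem cyc_decomposeFin_ne {n : ℕ} (p : Fin (n + 1)) (hp : p ≠ 0) (e : Equiv.Perm (Fin n)) :
    cyc (Equiv.Perm.decomposeFin.symm (p, e)) = cyc e := by
  have h := cyc_swap_mul (Equiv.Perm.decomposeFin.symm (0, e)) 0 p (by
    intro h
    exact hp (h.eq_of_left (by
      show Equiv.Perm.decomposeFin.symm (0, e) 0 = 0
      simp)).symm)
  rw [← decomposeFin_eq, cyc_decomposeFin_zero] at h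
  omega

/-- rising (c = 1) or falling (c = -1) factorial polynomial -/
def G (c : ℤ) (n : ℕ) : ℤ[X] := ∏ i ∈ Finset.range n, (X + C (c * i))

theorem G_succ (c : ℤ) (n : ℕ) : G c (n + 1) = G c n * (X + C (c * n)) :=
  Finset.prod_range_succ _ _

theorem sum_fin (c : ℤ) (hc : c * c = 1) (n : ℕ) :
    ∑ σ : Equiv.Perm (Fin n), C (c ^ (n + cyc σ)) * (X : ℤ[X]) ^ cyc σ = G c n := by
  induction n with
  | zero =>
    have : ∀ σ : Equiv.Perm (Fin 0), cyc σ = 0 := by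
      intro σ
      have := cyc_add_sum σ
      rw [Subsingleton.elim σ 1] at *
      simpa using this
    simp [this, G]
  | succ n ih =>
    rw [G_succ, ← ih, ← Equiv.Perm.decomposeFin.symm.sum_comp, Fintype.sum_prod_type,
      Fin.sum_univ_succ]
    simp only [cyc_decomposeFin_zero]
    have : ∀ (i : Fin n) (e : Equiv.Perm (Fin n)),
        cyc (Equiv.Perm.decomposeFin.symm (i.succ, e)) = cyc e :=
      fun i e => cyc_decomposeFin_ne _ (Fin.succ_ne_zero i) e
    simp only [this, Finset.sum_const, Finset.card_univ, Fintype.card_fin]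
    rw [mul_add, Finset.sum_mul, Finset.sum_mul, nsmul_eq_mul, Finset.mul_sum]
    refine congrArg₂ (· + ·) ?_ ?_
    · apply Finset.sum_congr rfl
      intro e _
      have : c ^ (n + 1 + (cyc e + 1)) = c ^ (n + cyc e) := by
        rw [show n + 1 + (cyc e + 1) = (n + cyc e) + 2 by ring, pow_add, sq, hc, mul_one]
      rw [this, pow_succ]; ring
    · apply Finset.sum_congr rfl
      intro e _
      simp only [map_mul, map_pow, map_natCast]
      ring

theorem sum_perm (c : ℤ) (hc : c * c = 1) {α : Type*} [Fintype α] [DecidableEq α] :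
    ∑ σ : Equiv.Perm α, C (c ^ (Fintype.card α + cyc σ)) * (X : ℤ[X]) ^ cyc σ
      = G c (Fintype.card α) := by
  rw [← sum_fin c hc]
  let f : α ≃ Fin (Fintype.card α) := Fintype.equivFin α
  refine Fintype.sum_equiv f.permCongr _ _ (fun σ => ?_)
  have : cyc (f.permCongr σ) = cyc σ := by
    let f' : α ≃ Subtype (fun _ : Fin (Fintype.card α) => True) :=
      f.trans (Equiv.subtypeUnivEquiv (fun _ => trivial)).symm
    have h := cyc_extendDomain f' σ
    have h2 : σ.extendDomain f' = f.permCongr σ := by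
      ext i
      rw [Equiv.Perm.extendDomain_apply_subtype _ _ trivial]
      rfl
    rw [h2] at h
    simp only [Fintype.card_fin] at h
    omega
  rw [this]

theorem sum_perm_one {α : Type*} [Fintype α] [DecidableEq α] :
    ∑ σ : Equiv.Perm α, (X : ℤ[X]) ^ cyc σ = G 1 (Fintype.card α) := by
  rw [← sum_perm 1 (by norm_num)]
  simp

theorem sum_perm_sign {α : Type*} [Fintype α] [DecidableEq α] :
    ∑ σ : Equiv.Perm α, C ((Equiv.Perm.sign σ : ℤˣ) : ℤ) * (X : ℤ[X]) ^ cyc σ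
      = G (-1) (Fintype.card α) := by
  rw [← sum_perm (-1) (by norm_num)]
  simp only [sign_eq_cyc]

end gen

section signed
set_option linter.unusedSectionVars false
open Polynomial
variable {α : Type*} [Fintype α] [DecidableEq α]

/-- `σ` preserves `S`. -/
abbrev Pres (σ : Equiv.Perm α) (S : Finset α) : Prop := ∀ x, σ x ∈ S ↔ x ∈ S

open Classical in
/-- sign of the restriction of `σ` to `S`, zero if `S` is not preserved. -/
def sg (σ : Equiv.Perm α) (S : Finset α) : ℤ :=
  if h : Pres σ S then ((Equiv.Perm.sign (σ.subtypePerm (p := fun x => x ∈ S) h) : ℤˣ) : ℤ) else 0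

theorem sg_of_not {σ : Equiv.Perm α} {S : Finset α} (h : ¬ Pres σ S) : sg σ S = 0 := dif_neg h

theorem sg_of_pres {σ : Equiv.Perm α} {S : Finset α} (h : Pres σ S) :
    sg σ S = ((Equiv.Perm.sign (σ.subtypePerm (p := fun x => x ∈ S) h) : ℤˣ) : ℤ) := dif_pos h

theorem Pres.mul {σ τ : Equiv.Perm α} {S : Finset α} (h : Pres σ S) (h' : Pres τ S) :
    Pres (σ * τ) S := fun x => (h _).trans (h' x)

theorem pres_mul_iff {σ τ : Equiv.Perm α} {S : Finset α} (h : Pres σ S) :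
    Pres (σ * τ) S ↔ Pres τ S :=
  ⟨fun h' x => (h _).symm.trans (h' x), fun h' => Pres.mul h h'⟩

theorem pres_mul_iff' {σ τ : Equiv.Perm α} {S : Finset α} (h : Pres τ S) :
    Pres (σ * τ) S ↔ Pres σ S :=
  ⟨fun h' x => by
    have h1 := h' (τ⁻¹ x)
    have h2 := h (τ⁻¹ x)
    rw [Equiv.Perm.mul_apply] at h1
    have h3 : τ (τ⁻¹ x) = x := τ.apply_symm_apply x
    rw [h3] at h1 h2
    exact h1.trans h2.symm, fun h' => Pres.mul h' h⟩

theorem sg_mul {σ τ : Equiv.Perm α} {S : Finset α} (h : Pres σ S) :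
    sg (σ * τ) S = sg σ S * sg τ S := by
  by_cases h' : Pres τ S
  · rw [sg_of_pres h, sg_of_pres h', sg_of_pres (Pres.mul h h'), ← Units.val_mul, ← map_mul,
      Equiv.Perm.subtypePerm_mul]
  · rw [sg_of_not h', sg_of_not (fun hh => h' ((pres_mul_iff h).1 hh)), mul_zero]

theorem pres_of_mapsTo {σ : Equiv.Perm α} {S : Finset α} (h : ∀ x ∈ S, σ x ∈ S) : Pres σ S := by
  intro x
  refine ⟨fun hx => ?_, h x⟩
  have himg : S.image σ = S := by
    apply Finset.eq_of_subset_of_card_le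
    · intro y hy
      obtain ⟨z, hz, rfl⟩ := Finset.mem_image.1 hy
      exact h z hz
    · rw [Finset.card_image_of_injective _ σ.injective]
  rw [← himg] at hx
  obtain ⟨z, hz, hzx⟩ := Finset.mem_image.1 hx
  rwa [← σ.injective hzx]

theorem sg_congr {σ τ : Equiv.Perm α} {S : Finset α} (h : Pres τ S) (hst : ∀ x ∈ S, σ x = τ x) :
    sg σ S = sg τ S := by
  have h' : Pres σ S := pres_of_mapsTo fun x hx => by rw [hst x hx]; exact (h x).2 hx
  rw [sg_of_pres h, sg_of_pres h']
  congr 2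
  ext x
  exact hst x x.2

theorem sg_eq_sign {σ τ : Equiv.Perm α} {S : Finset α} (h : Pres σ S) (hst : ∀ x ∈ S, τ x = σ x)
    (hn : ∀ x, x ∉ S → τ x = x) : sg σ S = ((Equiv.Perm.sign τ : ℤˣ) : ℤ) := by
  have : τ = Equiv.Perm.ofSubtype (σ.subtypePerm (p := fun x => x ∈ S) h) := by
    ext x
    by_cases hx : x ∈ S
    · rw [Equiv.Perm.ofSubtype_subtypePerm_of_mem _ hx, hst x hx]
    · rw [Equiv.Perm.ofSubtype_subtypePerm_of_not_mem _ hx, hn x hx]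
  rw [this, Equiv.Perm.sign_ofSubtype, sg_of_pres h]

theorem sg_swap {a b : α} {S : Finset α} (hab : a ≠ b) (ha : a ∈ S) (hb : b ∈ S) :
    Pres (Equiv.swap a b) S ∧ sg (Equiv.swap a b) S = -1 := by
  have h : Pres (Equiv.swap a b) S := pres_of_mapsTo fun x hx => by
    rw [Equiv.swap_apply_def]; split_ifs <;> assumption
  refine ⟨h, ?_⟩
  rw [sg_eq_sign (τ := Equiv.swap a b) h (fun _ _ => rfl), Equiv.Perm.sign_swap hab]
  · rfl
  · intro x hx
    exact Equiv.swap_apply_of_ne_of_ne (fun h => hx (h ▸ ha)) (fun h => hx (h ▸ hb))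

/-- The full-cycle indicator as a signed sum over invariant sets. -/
theorem indicator_full (σ : Equiv.Perm α) (x : α) :
    ∑ S ∈ (Finset.univ : Finset (Finset α)).filter (fun S => x ∉ S), (-1 : ℤ) ^ S.card * sg σ S
      = if cyc σ = 1 then 1 else 0 := by
  classical
  have : Nonempty α := ⟨x⟩
  split_ifs with hcyc
  · rw [cyc_eq_one_iff] at hcyc
    rw [Finset.sum_eq_single ∅]
    · have : Pres σ ∅ := fun x => by simp
      rw [sg_eq_sign (τ := 1) this]
      · simp
      · simp
      · simp
    · intro S hS hne
      rw [sg_of_not, mul_zero]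
      intro hp
      obtain ⟨y, hy⟩ := Finset.nonempty_iff_ne_empty.2 hne
      have := sameCycle_imp_of_apply σ (fun z => z ∈ S) (fun z => propext (hp z)) (hcyc y x)
      simp only [Finset.mem_filter] at hS
      exact hS.2 (this ▸ hy)
    · simp
  · rw [cyc_eq_one_iff] at hcyc
    have : ∃ y, ¬ σ.SameCycle y x := by
      by_contra! h
      exact hcyc fun a b => (h a).trans (h b).symm
    obtain ⟨y, hy⟩ := this
    set c : Finset α := Finset.univ.filter (fun z => σ.SameCycle y z) with hc
    have hcm : ∀ z, z ∈ c ↔ σ.SameCycle y z := fun z => by simp [hc]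
    have hcp : Pres σ c := fun z => by
      rw [hcm, hcm, Equiv.Perm.sameCycle_apply_right]
    have hcsgn : (-1 : ℤ) ^ c.card * ((Equiv.Perm.sign (σ.cycleOf y) : ℤˣ) : ℤ) = -1 := by
      by_cases hfix : σ y = y
      · have h1 : c = {y} := by
          ext z
          rw [hcm, Finset.mem_singleton]
          constructor
          · intro h; exact (h.eq_of_left hfix).symm
          · rintro rfl; rfl
        rw [(Equiv.Perm.cycleOf_eq_one_iff σ).2 hfix, h1]
        simp
      · have h1 : c = (σ.cycleOf y).support := by
          ext z
          rw [hcm, Equiv.Perm.mem_support_cycleOf_iff' hfix]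
        rw [(Equiv.Perm.isCycle_cycleOf σ hfix).sign, ← h1]
        push_cast
        rw [mul_neg, ← mul_pow]
        simp
    have key : ∀ S : Finset α, Pres σ S → y ∉ S →
        (-1 : ℤ) ^ (S ∪ c).card * sg σ (S ∪ c) = - ((-1 : ℤ) ^ S.card * sg σ S) := by
      intro S hS hyS
      have hdis : ∀ z ∈ c, z ∉ S := by
        intro z hz hzS
        have := sameCycle_imp_of_apply σ (fun z => z ∈ S) (fun z => propext (hS z)) ((hcm z).1 hz)
        exact hyS (this ▸ hzS)
      have hd : _root_.Disjoint S c := by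
        rw [Finset.disjoint_right]; exact hdis
      have hu : Pres σ (S ∪ c) := fun z => by
        rw [Finset.mem_union, Finset.mem_union, hS z, hcp z]
      set ρ := Equiv.Perm.ofSubtype (σ.subtypePerm (p := fun x => x ∈ S) hS) with hρ
      have hρ1 : ∀ z ∈ S, ρ z = σ z := fun z hz => Equiv.Perm.ofSubtype_subtypePerm_of_mem _ hz
      have hρ2 : ∀ z, z ∉ S → ρ z = z := fun z hz => Equiv.Perm.ofSubtype_subtypePerm_of_not_mem _ hz
      rw [sg_eq_sign (τ := ρ) hS hρ1 hρ2, sg_eq_sign (τ := ρ * σ.cycleOf y) hu,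
        Finset.card_union_of_disjoint hd, map_mul, Units.val_mul, pow_add]
      · calc _ = (-1 : ℤ) ^ S.card * ((Equiv.Perm.sign ρ : ℤˣ) : ℤ) *
              ((-1 : ℤ) ^ c.card * ((Equiv.Perm.sign (σ.cycleOf y) : ℤˣ) : ℤ)) := by ring
          _ = _ := by rw [hcsgn]; ring
      · intro z hz
        rw [Equiv.Perm.mul_apply]
        by_cases hzc : z ∈ c
        · rw [((hcm z).1 hzc).cycleOf_apply]
          exact hρ2 _ (hdis _ ((hcp z).2 hzc))
        · rw [Equiv.Perm.cycleOf_apply_of_not_sameCycle (fun h => hzc ((hcm z).2 h))]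
          exact hρ1 z ((Finset.mem_union.1 hz).resolve_right hzc)
      · intro z hz
        rw [Finset.mem_union, not_or] at hz
        rw [Equiv.Perm.mul_apply,
          Equiv.Perm.cycleOf_apply_of_not_sameCycle (fun h => hz.2 ((hcm z).2 h))]
        exact hρ2 z hz.1
    have hsymm : ∀ S, Pres σ S → Pres σ (symmDiff S c) := fun S hS z => by
      rw [Finset.mem_symmDiff, Finset.mem_symmDiff, hS z, hcp z]
    have hyc : y ∈ c := (hcm y).2 (Equiv.Perm.SameCycle.refl _ _)
    have hxc : x ∉ c := fun h => hy ((hcm x).1 h)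
    have key2 : ∀ S : Finset α, Pres σ S → y ∉ S →
        (-1 : ℤ) ^ S.card * sg σ S + (-1 : ℤ) ^ (symmDiff S c).card * sg σ (symmDiff S c) = 0 := by
      intro S hS hyS
      have hd : _root_.Disjoint S c := by
        rw [Finset.disjoint_right]
        intro z hz hzS
        have := sameCycle_imp_of_apply σ (fun z => z ∈ S) (fun z => propext (hS z)) ((hcm z).1 hz)
        exact hyS (this ▸ hzS)
      have : symmDiff S c = S ∪ c := hd.symmDiff_eq_sup
      rw [this, key S hS hyS]
      ring
    refine Finset.sum_involution (fun S _ => symmDiff S c) ?_ ?_ ?_ ?_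
    · intro S hS
      by_cases hp : Pres σ S
      · by_cases hyS : y ∈ S
        · have h1 := key2 (symmDiff S c) (hsymm S hp) (by
            rw [Finset.mem_symmDiff]; tauto)
          rw [symmDiff_symmDiff_cancel_right] at h1
          rw [add_comm]; exact h1
        · exact key2 S hp hyS
      · have : ¬ Pres σ (symmDiff S c) := fun h => hp (by
          have := hsymm _ h
          rwa [symmDiff_symmDiff_cancel_right] at this)
        rw [sg_of_not hp, sg_of_not this]; simp
    · intro S hS _ h
      have : y ∈ symmDiff S c ↔ y ∈ S := by rw [h]
      rw [Finset.mem_symmDiff] at this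
      tauto
    · intro S hS
      simp only [Finset.mem_filter, Finset.mem_univ, true_and] at hS ⊢
      rw [Finset.mem_symmDiff]; tauto
    · intro S hS
      exact symmDiff_symmDiff_cancel_right _ _

end signed

section qsec
open Polynomial
set_option linter.unusedSectionVars false
variable {α : Type*} [Fintype α] [DecidableEq α]

/-- signed count of full cycles `v` with `w * v` preserving `S` -/
def q (S : Finset α) (w : Equiv.Perm α) : ℤ := ∑ v : Equiv.Perm α, if cyc v = 1 then sg (w * v) S else 0

/-- signed count of two-cycle permutations -/
def cS (S : Finset α) : ℤ := ∑ v : Equiv.Perm α, if cyc v = 2 then sg v S else 0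

/-- signed cycle generating polynomial -/
def H (S : Finset α) : ℤ[X] := ∑ w : Equiv.Perm α, C (sg w S) * X ^ cyc w

theorem q_zero_aux {S : Finset α} {w v : Equiv.Perm α} {a a' : α} (hne : a ≠ a') (ha : a ∈ S)
    (ha' : a' ∈ S) (hw : w a ∉ S) (hw' : w a' ∉ S) (hp : Pres (w * v) S) :
    Pres (w * (swap a a' * v * (swap a a')⁻¹)) S ∧
      sg (w * (swap a a' * v * (swap a a')⁻¹)) S = - sg (w * v) S := by
  obtain ⟨hτ, hτs⟩ := sg_swap hne ha ha'
  have h1 : Pres ((w * v) * swap a a') S := Pres.mul hp hτ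
  have h2 : ∀ y ∈ S, (w * (swap a a' * v * (swap a a')⁻¹)) y = ((w * v) * swap a a') y := by
    intro y hy
    rw [swap_inv]
    simp only [Equiv.Perm.mul_apply]
    have h3 : w (v (swap a a' y)) ∈ S := (h1 y).2 hy
    rw [swap_apply_of_ne_of_ne (a := a) (b := a') (x := v (swap a a' y))]
    · intro h; rw [h] at h3; exact hw h3
    · intro h; rw [h] at h3; exact hw' h3
  refine ⟨pres_of_mapsTo fun y hy => ?_, ?_⟩
  · rw [h2 y hy]; exact (h1 y).2 hy
  · rw [sg_congr h1 h2, sg_mul hp, hτs]; ring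

theorem q_zero2 {S : Finset α} {w : Equiv.Perm α} {a a' : α} (hne : a ≠ a') (ha : a ∈ S)
    (ha' : a' ∈ S) (hw : w a ∉ S) (hw' : w a' ∉ S) : q S w = 0 := by
  have key : ∀ v : Equiv.Perm α,
      sg (w * (swap a a' * v * (swap a a')⁻¹)) S = - sg (w * v) S := by
    intro v
    by_cases hp : Pres (w * v) S
    · exact (q_zero_aux hne ha ha' hw hw' hp).2
    · have hnp : ¬ Pres (w * (swap a a' * v * (swap a a')⁻¹)) S := by
        intro h
        have := (q_zero_aux hne ha ha' hw hw' h).1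
        apply hp
        have e : swap a a' * (swap a a' * v * (swap a a')⁻¹) * (swap a a')⁻¹ = v := by
          rw [swap_inv]
          simp only [← mul_assoc, swap_mul_self, one_mul]
          rw [mul_assoc, swap_mul_self, mul_one]
        rwa [e] at this
      rw [sg_of_not hp, sg_of_not hnp, neg_zero]
  have : q S w = - q S w := by
    conv_lhs => rw [q, ← (MulAut.conj (swap a a')).toEquiv.sum_comp]
    rw [q, ← Finset.sum_neg_distrib]
    apply Finset.sum_congr rfl
    intro v _
    show (if cyc (swap a a' * v * (swap a a')⁻¹) = 1 then
      sg (w * (swap a a' * v * (swap a a')⁻¹)) S else 0) = _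
    simp only [cyc_conj, key]
    split_ifs <;> simp
  omega

theorem q_zero_pres {S : Finset α} {w : Equiv.Perm α} {x y : α} (hx : x ∉ S) (hy : y ∈ S)
    (hw : Pres w S) : q S w = 0 := by
  have : Nonempty α := ⟨x⟩
  apply Finset.sum_eq_zero
  intro v _
  split_ifs with h
  · rw [cyc_eq_one_iff] at h
    rw [sg_of_not]
    intro hp
    rw [pres_mul_iff hw] at hp
    have := sameCycle_imp_of_apply v (fun z => z ∈ S) (fun z => propext (hp z)) (h y x)
    exact hx (this ▸ hy)
  · rfl

theorem not_sameCycle_of_pres {S : Finset α} {v : Equiv.Perm α} {a b : α} (ha : a ∈ S) (hb : b ∉ S)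
    (hp : Pres v S) : ¬ v.SameCycle a b := by
  intro h
  have := sameCycle_imp_of_apply v (fun z => z ∈ S) (fun z => propext (hp z)) h
  exact hb (this ▸ ha)

theorem q_step {S : Finset α} {w : Equiv.Perm α} {a b : α} (ha : a ∈ S) (hb : b ∉ S)
    (hw : Pres w S) : q S (w * swap a b) = sg w S * cS S := by
  rw [q, ← Equiv.sum_comp (Equiv.mulLeft (swap a b)), cS, Finset.mul_sum]
  apply Finset.sum_congr rfl
  intro v _
  simp only [Equiv.coe_mulLeft]
  have e : w * swap a b * (swap a b * v) = w * v := by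
    rw [mul_assoc, ← mul_assoc (swap a b), swap_mul_self, one_mul]
  rw [e, sg_mul hw]
  by_cases hp : Pres v S
  · have h1 := cyc_swap_mul v a b (not_sameCycle_of_pres ha hb hp)
    have : cyc (swap a b * v) = 1 ↔ cyc v = 2 := by omega
    simp only [this]
    split_ifs <;> simp
  · rw [sg_of_not hp]; simp

open Classical in
theorem q_decomp {S : Finset α} {x y : α} (hx : x ∉ S) (hy : y ∈ S) (w : Equiv.Perm α) :
    q S w = ∑ a ∈ S, ∑ b ∈ Sᶜ, if Pres (w * swap a b) S then q S w else 0 := by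
  by_cases hq : q S w = 0
  · rw [hq]; simp
  have hnp : ¬ Pres w S := fun h => hq (q_zero_pres hx hy h)
  obtain ⟨a, ha, hwa⟩ : ∃ a ∈ S, w a ∉ S := by
    by_contra! h
    exact hnp (pres_of_mapsTo h)
  have hau : ∀ a' ∈ S, w a' ∉ S → a' = a := by
    intro a' ha' hwa'
    by_contra hne
    exact hq (q_zero2 hne ha' ha hwa' hwa)
  have hcard : (S \ S.image w).card = 1 := by
    rw [← Finset.card_sdiff_comm (Finset.card_image_of_injective S w.injective), Finset.card_eq_one]
    refine ⟨w a, ?_⟩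
    ext z
    simp only [Finset.mem_sdiff, Finset.mem_image, Finset.mem_singleton]
    constructor
    · rintro ⟨⟨u, hu, rfl⟩, hz⟩
      rw [hau u hu hz]
    · rintro rfl
      exact ⟨⟨a, ha, rfl⟩, hwa⟩
  obtain ⟨z, hz⟩ := Finset.card_eq_one.1 hcard
  obtain ⟨b, rfl⟩ := w.surjective z
  have hzm : ∀ u, u ∉ S → w u ∈ S → u = b := by
    intro u hu hwu
    have : w u ∈ S \ S.image w := by
      rw [Finset.mem_sdiff]
      refine ⟨hwu, fun h => ?_⟩
      obtain ⟨t, ht, htu⟩ := Finset.mem_image.1 h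
      exact hu (w.injective htu ▸ ht)
    rw [hz, Finset.mem_singleton] at this
    exact w.injective this
  have hb0 : w b ∈ S \ S.image w := by rw [hz]; simp
  rw [Finset.mem_sdiff] at hb0
  have hb : b ∉ S := fun h => hb0.2 (Finset.mem_image_of_mem _ h)
  rw [Finset.sum_eq_single a, Finset.sum_eq_single b, if_pos]
  · apply pres_of_mapsTo
    intro u hu
    rw [Equiv.Perm.mul_apply]
    by_cases hua : u = a
    · rw [hua, swap_apply_left]; exact hb0.1
    · rw [swap_apply_of_ne_of_ne hua (fun h => hb (by rw [← h]; exact hu))]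
      by_contra h
      exact hua (hau u hu h)
  · intro b' hb' hne
    rw [Finset.mem_compl] at hb'
    rw [if_neg]
    intro hp
    have := hp b
    rw [Equiv.Perm.mul_apply, swap_apply_of_ne_of_ne (fun h => hb (by rw [h]; exact ha)) (Ne.symm hne)] at this
    exact hb (this.1 hb0.1)
  · intro h; exact absurd (Finset.mem_compl.2 hb) h
  · intro a' ha' hne
    apply Finset.sum_eq_zero
    intro b' hb'
    rw [Finset.mem_compl] at hb'
    rw [if_neg]
    intro hp
    have := hp a
    rw [Equiv.Perm.mul_apply, swap_apply_of_ne_of_ne (Ne.symm hne) (fun h => hb' (by rw [← h]; exact ha))] at this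
    exact hwa (this.2 ha)
  · intro h; exact absurd ha h

theorem cyc_mul_swap {S : Finset α} {w : Equiv.Perm α} {a b : α} (ha : a ∈ S) (hb : b ∉ S)
    (hw : Pres w S) : cyc (w * swap a b) + 1 = cyc w := by
  rw [← cyc_swap_mul w a b (not_sameCycle_of_pres ha hb hw), ← cyc_conj (w * swap a b) (swap a b),
    swap_inv]
  congr 2
  rw [mul_assoc, mul_assoc, swap_mul_self, mul_one]

theorem q_gen {S : Finset α} {x y : α} (hx : x ∉ S) (hy : y ∈ S) :
    X * ∑ w : Equiv.Perm α, C (q S w) * X ^ cyc w =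
      C ((S.card : ℤ) * (Sᶜ.card : ℤ) * cS S) * H S := by
  classical
  have h1 : ∀ a ∈ S, ∀ b ∈ Sᶜ,
      ∑ w : Equiv.Perm α, X * (C (if Pres (w * swap a b) S then q S w else 0) * X ^ cyc w)
        = C (cS S) * H S := by
    intro a ha b hb
    rw [Finset.mem_compl] at hb
    rw [← Equiv.sum_comp (Equiv.mulRight (swap a b)), H, Finset.mul_sum]
    apply Finset.sum_congr rfl
    intro w _
    have e : w * swap a b * swap a b = w := by rw [mul_assoc w, swap_mul_self, mul_one]
    simp only [Equiv.coe_mulRight, e]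
    split_ifs with hp
    · rw [q_step ha hb hp, ← cyc_mul_swap ha hb hp, map_mul, pow_succ]
      ring
    · rw [sg_of_not hp]; simp
  calc X * ∑ w : Equiv.Perm α, C (q S w) * X ^ cyc w
      = ∑ w : Equiv.Perm α, ∑ a ∈ S, ∑ b ∈ Sᶜ,
          X * (C (if Pres (w * swap a b) S then q S w else 0) * X ^ cyc w) := by
        rw [Finset.mul_sum]
        apply Finset.sum_congr rfl
        intro w _
        conv_lhs => rw [q_decomp hx hy w]
        simp only [map_sum, Finset.sum_mul, Finset.mul_sum]
    _ = ∑ a ∈ S, ∑ b ∈ Sᶜ, ∑ w : Equiv.Perm α,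
          X * (C (if Pres (w * swap a b) S then q S w else 0) * X ^ cyc w) := by
        rw [Finset.sum_comm]
        apply Finset.sum_congr rfl
        intro a _
        rw [Finset.sum_comm]
    _ = ∑ a ∈ S, ∑ b ∈ Sᶜ, C (cS S) * H S := 
        Finset.sum_congr rfl fun a ha => Finset.sum_congr rfl fun b hb => h1 a ha b hb
    _ = _ := by
        simp only [Finset.sum_const, nsmul_eq_mul, map_mul, map_natCast]
        ring

theorem cS_eq (S : Finset α) : cS S = (H S).coeff 2 := by
  rw [cS, H, finsetSum_coeff]
  apply Finset.sum_congr rfl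
  intro v _
  rw [coeff_C_mul, coeff_X_pow]
  simp only [eq_comm (a := 2)]
  split_ifs <;> simp

end qsec

section hsec
open Polynomial
set_option linter.unusedSectionVars false
variable {α : Type*} [Fintype α] [DecidableEq α]

theorem H_eq (S : Finset α) : H S = G (-1) S.card * G 1 Sᶜ.card := by
  have e1 : G (-1) S.card = ∑ σ : Equiv.Perm {x // x ∈ S},
      C ((Equiv.Perm.sign σ : ℤˣ) : ℤ) * (X : ℤ[X]) ^ cyc σ := by
    rw [sum_perm_sign, Fintype.card_coe]
  have e2 : G 1 Sᶜ.card = ∑ σ : Equiv.Perm {x // x ∉ S}, (X : ℤ[X]) ^ cyc σ := by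
    rw [sum_perm_one, Fintype.card_subtype_compl, Fintype.card_coe, Finset.card_compl]
  rw [e1, e2, Finset.sum_mul_sum, ← Finset.sum_product', H]
  symm
  let e : Equiv.Perm {x // x ∈ S} × Equiv.Perm {x // x ∉ S} → Equiv.Perm α :=
    fun p => Equiv.Perm.ofSubtype p.1 * Equiv.Perm.ofSubtype p.2
  have he1 : ∀ p, ∀ y (hy : y ∈ S), e p y = p.1 ⟨y, hy⟩ := by
    intro p y hy
    simp only [e, Equiv.Perm.mul_apply]
    rw [Equiv.Perm.ofSubtype_apply_of_not_mem p.2 (by simpa using hy),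
      Equiv.Perm.ofSubtype_apply_of_mem p.1 hy]
  have he2 : ∀ p, ∀ y (hy : y ∉ S), e p y = p.2 ⟨y, hy⟩ := by
    intro p y hy
    simp only [e, Equiv.Perm.mul_apply]
    rw [Equiv.Perm.ofSubtype_apply_of_mem p.2 hy,
      Equiv.Perm.ofSubtype_apply_of_not_mem p.1 (p.2 ⟨y, hy⟩).2]
  have hep : ∀ p, Pres (e p) S := fun p => pres_of_mapsTo fun y hy => by
    rw [he1 p y hy]; exact (p.1 ⟨y, hy⟩).2
  refine Fintype.sum_of_injective e ?_ _ _ ?_ ?_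
  · intro p p' h
    ext z
    · rw [← he1 p z z.2, h, he1 p' z z.2]
    · rw [← he2 p z z.2, h, he2 p' z z.2]
  · intro w hw
    rw [sg_of_not, map_zero, zero_mul]
    intro hp
    apply hw
    refine ⟨(w.subtypePerm (p := fun x => x ∈ S) hp,
      w.subtypePerm (p := fun x => x ∉ S) (fun x => not_congr (hp x))), ?_⟩
    ext y
    by_cases hy : y ∈ S
    · rw [he1 _ y hy]; rfl
    · rw [he2 _ y hy]; rfl
  · intro p
    have hs : sg (e p) S = ((Equiv.Perm.sign p.1 : ℤˣ) : ℤ) := by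
      rw [sg_of_pres (hep p)]
      congr 2
      ext y
      exact he1 p y y.2
    have hc : cyc (e p) = cyc p.1 + cyc p.2 := by
      have hd : Equiv.Perm.Disjoint (Equiv.Perm.ofSubtype p.1) (Equiv.Perm.ofSubtype p.2) := by
        intro y
        by_cases hy : y ∈ S
        · right; exact Equiv.Perm.ofSubtype_apply_of_not_mem p.2 (by simpa using hy)
        · left; exact Equiv.Perm.ofSubtype_apply_of_not_mem p.1 hy
      have h0 := cyc_add_sum (e p)
      have h1 := cyc_add_sum p.1
      have h2 := cyc_add_sum p.2
      have h3 : (e p).cycleType = p.1.cycleType + p.2.cycleType := by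
        simp only [e]
        rw [hd.cycleType_mul, Equiv.Perm.cycleType_ofSubtype, Equiv.Perm.cycleType_ofSubtype]
      rw [h3, Multiset.sum_add, Multiset.card_add] at h0
      have h4 : Fintype.card {x // x ∉ S} + Fintype.card {x // x ∈ S} = Fintype.card α := by
        rw [Fintype.card_subtype_compl, Nat.sub_add_cancel]
        exact Fintype.card_subtype_le _
      omega
    rw [hs, hc, pow_add]; ring

theorem G_coeff_zero (c : ℤ) (n : ℕ) : (G c (n + 1)).coeff 0 = 0 := by
  induction n with
  | zero => simp [G]
  | succ n ih => rw [G_succ, mul_coeff_zero, ih, zero_mul]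

theorem G_coeff_one (c : ℤ) (n : ℕ) : (G c (n + 1)).coeff 1 = c ^ n * (n.factorial : ℤ) := by
  induction n with
  | zero => simp [G]
  | succ n ih =>
    rw [G_succ, mul_add, coeff_add, coeff_mul_X, G_coeff_zero, coeff_mul_C, ih, Nat.factorial_succ]
    push_cast
    ring

theorem cS_val (S : Finset α) {s t : ℕ} (hs : S.card = s + 1) (ht : Sᶜ.card = t + 1) :
    cS S = (-1) ^ s * (s.factorial : ℤ) * (t.factorial : ℤ) := by
  rw [cS_eq, H_eq, hs, ht, coeff_mul]
  have : (Finset.HasAntidiagonal.antidiagonal 2 : Finset (ℕ × ℕ)) = {(0, 2), (1, 1), (2, 0)} := by decide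
  rw [this]
  simp [G_coeff_zero, G_coeff_one, mul_assoc]

theorem card_full [Nonempty α] : ∑ v : Equiv.Perm α, (if cyc v = 1 then (1 : ℤ) else 0) =
    ((Fintype.card α - 1).factorial : ℤ) := by
  have h := congrArg (fun p => coeff p 1) (sum_perm_one (α := α))
  obtain ⟨n, hn⟩ : ∃ n, Fintype.card α = n + 1 := ⟨_, (Nat.succ_pred_eq_of_pos Fintype.card_pos).symm⟩
  simp only [finsetSum_coeff, hn, G_coeff_one, coeff_X_pow, one_pow, one_mul,
    eq_comm (a := 1)] at h
  rw [h, hn]; rfl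

/-- signed contribution of each set -/
def Q (S : Finset α) : ℤ[X] := C ((-1) ^ S.card) * ∑ w : Equiv.Perm α, C (q S w) * X ^ cyc w

theorem Q_empty [Nonempty α] : Q (∅ : Finset α) = 
    C ((Fintype.card α - 1).factorial : ℤ) * G 1 (Fintype.card α) := by
  have : ∀ w : Equiv.Perm α, q ∅ w = ((Fintype.card α - 1).factorial : ℤ) := by
    intro w
    rw [← card_full (α := α), q]
    apply Finset.sum_congr rfl
    intro v _
    have hp : Pres (w * v) ∅ := fun x => by simp
    have : sg (w * v) ∅ = 1 := by
      rw [sg_eq_sign (τ := 1) hp] <;> simp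
    rw [this]
  rw [Q]
  simp only [this, Finset.card_empty, pow_zero, map_one, one_mul]
  rw [← Finset.mul_sum, sum_perm_one]

theorem X_Q (S : Finset α) {x : α} (hx : x ∉ S) {s t : ℕ} (hs : S.card = s + 1)
    (ht : Sᶜ.card = t + 1) :
    X * Q S = - (C (((s + 1).factorial : ℤ) * ((t + 1).factorial : ℤ)) * (G (-1) (s + 1) * G 1 (t + 1))) := by
  obtain ⟨y, hy⟩ : S.Nonempty := Finset.card_pos.1 (by omega)
  rw [Q, mul_left_comm, q_gen hx hy, H_eq, cS_val S hs ht, hs, ht, ← mul_assoc, ← map_mul, ← neg_mul,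
    ← map_neg]
  congr 2
  rw [Nat.factorial_succ, Nat.factorial_succ]
  have : ((-1 : ℤ) ^ s) * ((-1) ^ s) = 1 := by rw [← mul_pow]; simp
  push_cast
  rw [pow_succ]
  linear_combination (-((s : ℤ) + 1) * (t + 1) * s.factorial * t.factorial) * this

/-- generating polynomial of pairs -/
def P (α : Type*) [Fintype α] [DecidableEq α] : ℤ[X] :=
  ∑ w : Equiv.Perm α, C (∑ v : Equiv.Perm α,
    if cyc v = 1 then (if cyc (w * v) = 1 then 1 else 0) else 0) * X ^ cyc w

theorem P_eq (x : α) : P α = 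
    ∑ S ∈ (Finset.univ : Finset (Finset α)).filter (fun S => x ∉ S), Q S := by
  simp only [Q, Finset.mul_sum]
  rw [Finset.sum_comm, P]
  apply Finset.sum_congr rfl
  intro w _
  rw [← Finset.sum_congr rfl fun S _ => mul_assoc _ _ _, ← Finset.sum_mul]
  congr 1
  simp only [← map_mul, ← map_sum]
  congr 1
  simp only [q, Finset.mul_sum]
  rw [Finset.sum_comm]
  apply Finset.sum_congr rfl
  intro v _
  rw [← indicator_full (w * v) x]
  split_ifs
  · rfl
  · simp

end hsec

section psec
open Polynomial

theorem tele (N J r : ℕ) (h : N = J + r) :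
    ((N : ℤ[X]) + 1) * ((N : ℤ[X]) + 2) * ∑ i ∈ Finset.range J, ((i : ℤ[X]) + 1) * (G 1 (i + 1) * G (-1) (N - i))
      = ((N : ℤ[X]) + 2) * (J : ℤ[X]) * (G 1 (J + 1) * G (-1) (r + 1)) - G 1 (J + 1) * G (-1) (r + 2)
        + X * G (-1) (N + 2) := by
  induction J generalizing r with
  | zero =>
    have : r = N := by omega
    subst this
    simp [G]
  | succ J ih =>
    rw [Finset.sum_range_succ, mul_add, ih (r + 1) (by omega), show N - J = r + 1 by omega,
      G_succ 1 (J + 1), G_succ (-1) (r + 2), G_succ (-1) (r + 1)]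
    have hN : (N : ℤ[X]) = J + 1 + r := by rw [h]; push_cast; ring
    rw [hN]
    push_cast
    simp only [map_mul, map_add, map_neg, map_one, map_natCast]
    push_cast
    simp only [map_add, map_one, map_natCast, map_ofNat]
    ring

theorem X_P (N : ℕ) {α : Type*} [Fintype α] [DecidableEq α] (hα : Fintype.card α = N + 1) :
    X * P α = C (N.factorial : ℤ) * (X * G 1 (N + 1) -
      ∑ i ∈ Finset.range N, ((i : ℤ[X]) + 1) * (G 1 (i + 1) * G (-1) (N - i))) := by
  have hne : Nonempty α := Fintype.card_pos_iff.1 (by omega)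
  obtain ⟨x⟩ := id hne
  let F : ℕ → ℤ[X] := fun k => match k with
    | 0 => X * (C (N.factorial : ℤ) * G 1 (N + 1))
    | s + 1 => - (C (((s + 1).factorial : ℤ) * ((N - s).factorial : ℤ)) * (G (-1) (s + 1) * G 1 (N - s)))
  have hset : (Finset.univ : Finset (Finset α)).filter (fun S => x ∉ S)
      = (Finset.univ.erase x).powerset := by
    ext S
    simp only [Finset.mem_filter, Finset.mem_univ, true_and, Finset.mem_powerset, Finset.subset_erase,
      Finset.subset_univ]
  have hcard : (Finset.univ.erase x).card = N := by
    rw [Finset.card_erase_of_mem (Finset.mem_univ _), Finset.card_univ, hα]; rfl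
  have hF : ∀ S ∈ (Finset.univ.erase x).powerset, X * Q S = F S.card := by
    intro S hS
    rw [← hset, Finset.mem_filter] at hS
    rcases hk : S.card with _ | s
    · rw [Finset.card_eq_zero] at hk
      rw [hk, Q_empty, hα]; rfl
    · have hlt : S.card < Fintype.card α := by
        rw [← Finset.card_univ]
        exact Finset.card_lt_card (Finset.ssubset_univ_iff.2 (fun h => hS.2 (h ▸ Finset.mem_univ x)))
      obtain ⟨t, ht⟩ : ∃ t, N - s = t + 1 := ⟨N - s - 1, by omega⟩
      have hc : Sᶜ.card = t + 1 := by rw [Finset.card_compl]; omega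
      rw [X_Q S hS.2 hk hc]
      simp only [F, ht]
  rw [P_eq x, hset, Finset.mul_sum, Finset.sum_congr rfl hF, Finset.sum_powerset_apply_card, hcard,
    Finset.sum_range_succ', mul_sub, sub_eq_neg_add, Finset.mul_sum, ← Finset.sum_neg_distrib]
  refine congrArg₂ (· + ·) ?_ ?_
  · rw [← Finset.sum_range_reflect]
    apply Finset.sum_congr rfl
    intro i hi
    rw [Finset.mem_range] at hi
    obtain ⟨j, rfl⟩ : ∃ j, N = i + 1 + j := ⟨N - (i + 1), by omega⟩
    have e1 : i + 1 + j - 1 - i = j := by omega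
    have e2 : i + 1 + j - j = i + 1 := by omega
    have e3 : i + 1 + j - i = j + 1 := by omega
    rw [e1, e3]
    simp only [F, e2]
    have hch : ((i + 1 + j).choose (j + 1)) * (j + 1).factorial * (i + 1).factorial
        = (i + 1 + j).factorial * (i + 1) := by
      have := Nat.choose_mul_factorial_mul_factorial (n := i + 1 + j) (k := j + 1) (by omega)
      rw [show i + 1 + j - (j + 1) = i by omega] at this
      rw [Nat.factorial_succ i, ← this]; ring
    have hch' : (((i + 1 + j).choose (j + 1) : ℕ) : ℤ[X]) * ((j + 1).factorial : ℤ[X]) * ((i + 1).factorial : ℤ[X])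
        = ((i + 1 + j).factorial : ℤ[X]) * (i + 1) := by exact_mod_cast congrArg (Nat.cast (R := ℤ[X])) hch
    simp only [nsmul_eq_mul, map_mul, map_natCast]
    linear_combination (-(G (-1) (j + 1) * G 1 (i + 1))) * hch'
  · simp only [F, Nat.choose_zero_right, one_smul]
    ring

theorem P_formula (N : ℕ) {α : Type*} [Fintype α] [DecidableEq α] (hα : Fintype.card α = N + 1) :
    ((N : ℤ[X]) + 1) * (N + 2) * P α = C (N.factorial : ℤ) * (G 1 (N + 2) - G (-1) (N + 2)) := by
  have h1 := X_P N hα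
  have h2 := tele N N 0 (by omega)
  apply mul_left_cancel₀ (X_ne_zero (R := ℤ))
  have h3 : G (-1) (0 + 1) = X := by simp [G]
  have h4 : G (-1) (0 + 2) = X * (X - 1) := by
    simp [G, Finset.prod_range_succ, sub_eq_add_neg]
  have h5 : G 1 (N + 2) = G 1 (N + 1) * (X + ((N : ℤ[X]) + 1)) := by
    rw [G_succ]; simp
  rw [h3, h4] at h2
  rw [h5]
  linear_combination ((N : ℤ[X]) + 1) * (N + 2) * h1 - C (N.factorial : ℤ) * h2

end psec

section fin
open Polynomial

theorem G_coeff (c : ℤ) (hc : c * c = 1) (n k : ℕ) :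
    (G c n).coeff k = c ^ (n + k) * (stirlingCycle n k : ℤ) := by
  rw [← sum_fin c hc, finsetSum_coeff, stirlingCycle, Nat.card_eq_fintype_card,
    Fintype.card_subtype, Finset.card_filter, Nat.cast_sum, Finset.mul_sum]
  apply Finset.sum_congr rfl
  intro σ _
  rw [coeff_C_mul, coeff_X_pow]
  simp only [cycleCount_eq_cyc]
  by_cases h : cyc σ = k
  · simp [h]
  · simp [h, Ne.symm h]

/-- pair counts -/
def M (n m k : ℕ) : ℕ := ∑ w : Equiv.Perm (Fin n), ∑ v : Equiv.Perm (Fin n),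
  if cyc v = 1 ∧ cyc (w * v) = 1 ∧ cyc w = k ∧ (∀ i : Fin n, (i : ℕ) < m → w i = i) then 1 else 0

theorem card_eq_M (n m k : ℕ) : Nat.card {p : Equiv.Perm (Fin n) × Equiv.Perm (Fin n) //
        IsFullCycle p.1 ∧ IsFullCycle p.2 ∧
        cycleCount (p.1 * p.2) = k ∧ ∀ i : Fin n, (i : ℕ) < m → (p.1 * p.2) i = i} = M n m k := by
  let e : Equiv.Perm (Fin n) × Equiv.Perm (Fin n) ≃ Equiv.Perm (Fin n) × Equiv.Perm (Fin n) :=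
    { toFun := fun p => (p.1 * p.2, p.2⁻¹)
      invFun := fun p => (p.1 * p.2, p.2⁻¹)
      left_inv := fun p => by simp
      right_inv := fun p => by simp }
  rw [Nat.card_congr (Equiv.subtypeEquiv e (q := fun p => cyc p.2 = 1 ∧ cyc (p.1 * p.2) = 1 ∧
    cyc p.1 = k ∧ (∀ i : Fin n, (i : ℕ) < m → p.1 i = i)) ?_)]
  · rw [Nat.card_eq_fintype_card, Fintype.card_subtype, Finset.card_filter, Fintype.sum_prod_type, M]
  · rintro ⟨u, v⟩
    simp only [e, Equiv.coe_fn_mk, IsFullCycle, cycleCount_eq_cyc, cyc_inv, mul_inv_cancel_right]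
    tauto

theorem M_zero (N k : ℕ) (hpar : Even (N + 1 + k)) :
    (N + 1) * (N + 2) * M (N + 1) 0 k = 2 * N.factorial * stirlingCycle (N + 2) k := by
  have h := P_formula N (α := Fin (N + 1)) (by simp)
  have hP : (P (Fin (N + 1))).coeff k = (M (N + 1) 0 k : ℤ) := by
    rw [P, finsetSum_coeff, M, Nat.cast_sum]
    apply Finset.sum_congr rfl
    intro w _
    rw [coeff_C_mul, coeff_X_pow, Finset.sum_mul, Nat.cast_sum]
    apply Finset.sum_congr rfl
    intro v _
    by_cases h1 : cyc v = 1 <;> by_cases h2 : cyc (w * v) = 1 <;> by_cases h3 : cyc w = k <;>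
      simp [h1, h2, h3, eq_comm (a := k)]
  have h' := congrArg (fun p => coeff p k) h
  have e : ((N : ℤ[X]) + 1) * (N + 2) = C (((N : ℤ) + 1) * (N + 2)) := by simp
  simp only [e, coeff_C_mul, coeff_sub, hP] at h'
  rw [G_coeff 1 (by norm_num), G_coeff (-1) (by norm_num)] at h'
  have : (-1 : ℤ) ^ (N + 2 + k) = -1 := by
    apply Odd.neg_one_pow
    rw [show N + 2 + k = N + 1 + k + 1 by ring]
    exact hpar.add_one
  rw [this] at h'
  zify
  rw [h']
  simp
  ring

theorem cyc_pos' {n : ℕ} (σ : Equiv.Perm (Fin (n + 1))) : cyc σ ≠ 0 := by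
  rw [← card_image_lab, Finset.card_ne_zero]
  exact ⟨_, Finset.mem_image_of_mem _ (Finset.mem_univ 0)⟩

theorem dec_mul {n : ℕ} (w v : Equiv.Perm (Fin n)) (j : Fin n) :
    Equiv.Perm.decomposeFin.symm (0, w) * Equiv.Perm.decomposeFin.symm (j.succ, v) =
      Equiv.Perm.decomposeFin.symm ((w j).succ, w * v) := by
  rw [decomposeFin_eq j.succ, decomposeFin_eq (w j).succ, ← mul_assoc, Equiv.mul_swap_eq_swap_mul,
    mul_assoc]
  refine congrArg₂ (· * ·) ?_ ?_
  · simp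
  · ext i
    refine Fin.cases ?_ (fun l => ?_) i
    · rw [Equiv.Perm.mul_apply]; simp
    · rw [Equiv.Perm.mul_apply]; simp

theorem M_succ (n m k : ℕ) : M (n + 2) (m + 1) (k + 1) = (n + 1) * M (n + 1) m k := by
  rw [M, ← Equiv.sum_comp Equiv.Perm.decomposeFin.symm, Fintype.sum_prod_type, Fin.sum_univ_succ]
  have hz : ∑ i : Fin (n + 1), ∑ w0 : Equiv.Perm (Fin (n + 1)), ∑ v : Equiv.Perm (Fin (n + 2)),
      (if cyc v = 1 ∧ cyc (Equiv.Perm.decomposeFin.symm (i.succ, w0) * v) = 1 ∧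
        cyc (Equiv.Perm.decomposeFin.symm (i.succ, w0)) = k + 1 ∧
        (∀ l : Fin (n + 2), (l : ℕ) < m + 1 → Equiv.Perm.decomposeFin.symm (i.succ, w0) l = l)
        then 1 else 0) = 0 := by
    apply Finset.sum_eq_zero; intro i _
    apply Finset.sum_eq_zero; intro w0 _
    apply Finset.sum_eq_zero; intro v _
    rw [if_neg]
    rintro ⟨-, -, -, h⟩
    have := h 0 (by simp)
    rw [Equiv.Perm.decomposeFin_symm_apply_zero] at this
    exact Fin.succ_ne_zero _ this
  rw [hz, add_zero, M, Finset.mul_sum]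
  apply Finset.sum_congr rfl
  intro w0 _
  rw [← Equiv.sum_comp Equiv.Perm.decomposeFin.symm, Fintype.sum_prod_type, Fin.sum_univ_succ]
  have hz2 : ∀ (c : Equiv.Perm (Fin (n + 1)) → Prop) [DecidablePred c],
      ∑ v0 : Equiv.Perm (Fin (n + 1)), (if cyc (Equiv.Perm.decomposeFin.symm (0, v0)) = 1 ∧ c v0
        then 1 else 0) = 0 := by
    intro c _
    apply Finset.sum_eq_zero; intro v0 _
    rw [if_neg]
    rintro ⟨h, -⟩
    rw [cyc_decomposeFin_zero] at h
    exact cyc_pos' v0 (by omega)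
  rw [hz2, zero_add]
  have hfix : (∀ l : Fin (n + 2), (l : ℕ) < m + 1 → Equiv.Perm.decomposeFin.symm (0, w0) l = l) ↔
      ∀ l : Fin (n + 1), (l : ℕ) < m → w0 l = l := by
    rw [Fin.forall_fin_succ]
    simp
  simp only [dec_mul, cyc_decomposeFin_zero, cyc_decomposeFin_ne _ (Fin.succ_ne_zero _), hfix,
    Finset.sum_const, Finset.card_univ, Fintype.card_fin, smul_eq_mul, Nat.add_right_cancel_iff]

theorem M_main (m : ℕ) : ∀ N k : ℕ, m ≤ N → m ≤ k → Even (N + 1 + k) →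
    (N + 1 - m) * (N + 2 - m) * M (N + 1) m k
      = 2 * N.factorial * stirlingCycle (N + 2 - m) (k - m) := by
  induction m with
  | zero => intro N k _ _ h; exact M_zero N k h
  | succ m ih =>
    intro N k hN hk h
    obtain ⟨N, rfl⟩ : ∃ N', N = N' + 1 := ⟨N - 1, by omega⟩
    obtain ⟨k, rfl⟩ : ∃ k', k = k' + 1 := ⟨k - 1, by omega⟩
    have h1 := ih N k (by omega) (by omega) (by
      rw [show N + 1 + 1 + (k + 1) = N + 1 + k + 2 by ring] at h
      simpa [Nat.even_add] using h)
    rw [M_succ, Nat.factorial_succ, show N + 1 + 1 - (m + 1) = N + 1 - m by omega,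
      show N + 1 + 2 - (m + 1) = N + 2 - m by omega, show k + 1 - (m + 1) = k - m by omega]
    calc _ = (N + 1) * ((N + 1 - m) * (N + 2 - m) * M (N + 1) m k) := by ring
      _ = _ := by rw [h1]; ring

end fin

/-- For `n ≥ 1`, `m < n`, `m ≤ k ≤ n` with `n - k` even, the number of
ordered pairs `(u, v)` of `n`-cycles on `[n]` whose product `u ∘ v` has exactly `k` cycles
and fixes every element of `[m]` equals `2 (n-1)! C(n+1-m, k-m) / ((n-m)(n+1-m))`;
equivalently, `(n-m)(n+1-m)` times this number equals `2 (n-1)! C(n+1-m, k-m)`. -/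
theorem fixed_pair_count (n m k : ℕ) (hn : 1 ≤ n) (hm : m < n)
    (hmk : m ≤ k) (hkn : k ≤ n) (hpar : Even (n - k)) :
    (n - m) * (n + 1 - m) *
      Nat.card {p : Equiv.Perm (Fin n) × Equiv.Perm (Fin n) //
        IsFullCycle p.1 ∧ IsFullCycle p.2 ∧
        cycleCount (p.1 * p.2) = k ∧ ∀ i : Fin n, (i : ℕ) < m → (p.1 * p.2) i = i} =
    2 * Nat.factorial (n - 1) * stirlingCycle (n + 1 - m) (k - m) := by
  rw [card_eq_M]
  obtain ⟨N, rfl⟩ : ∃ N, n = N + 1 := ⟨n - 1, by omega⟩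
  have := M_main m N k (by omega) hmk (by
    obtain ⟨r, hr⟩ := hpar
    exact ⟨r + k, by omega⟩)
  exact this
end
end

section
/- Let n ≥ 1 and 1 ≤ m ≤ n with n − m odd. Then the number of ordered pairs (u, v) of n-cycles on [n] such that the elements 1, …, m lie in pairwise distinct cycles of the product u∘v equals ((n−1)!)² / m!; equivalently, m! times this number of pairs equals ((n−1)!)². In particular, the probability that the product of two independent uniformly random n-cycles separates [m] is 1/m! in this case. -/
open Equiv Finset

noncomputable section

open Equiv Finset

namespace SepOdd

set_option linter.unusedSectionVars false
set_option linter.unusedVariables false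

section
open scoped Classical

variable {α : Type} [Fintype α] [DecidableEq α]

/-- `σ` acts transitively. -/
def Full {α : Type} (σ : Perm α) : Prop := ∀ x y, σ.SameCycle x y

/-- `σ` fixes `x` and acts transitively on the rest. -/
def Alm {α : Type} (x : α) (σ : Perm α) : Prop :=
  σ x = x ∧ ∀ y z, y ≠ x → z ≠ x → σ.SameCycle y z

/-- `σ` separates the elements of `M`. -/
def Sep {α : Type} (M : Finset α) (σ : Perm α) : Prop :=
  ∀ i ∈ M, ∀ j ∈ M, i ≠ j → ¬ σ.SameCycle i j

lemma sc_of_step {β : Type} {σ : Perm β} (E : β → β → Prop) (hE : Equivalence E)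
    (h : ∀ p, E p (σ p)) {p q : β} (hpq : σ.SameCycle p q) : E p q := by
  have hnat : ∀ (k : ℕ) (p : β), E p ((σ ^ k) p) := by
    intro k
    induction k with
    | zero => intro p; simpa using hE.refl p
    | succ k ih =>
      intro p
      rw [pow_succ']
      exact hE.trans (ih p) (h _)
  obtain ⟨i, rfl⟩ := hpq
  cases i with
  | ofNat k => exact hnat k p
  | negSucc k =>
    have := hnat (k+1) ((σ ^ (Int.negSucc k)) p)
    rw [zpow_negSucc] at this ⊢
    have h2 : (σ ^ (k+1)) ((σ ^ (k+1))⁻¹ p) = p := by simp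
    rw [h2] at this
    exact hE.symm this

lemma sc_equiv {β : Type} (σ : Perm β) : Equivalence σ.SameCycle :=
  ⟨Perm.SameCycle.refl σ, fun h => h.symm, fun h g => h.trans g⟩

lemma sc_equiv' {β γ : Type} (σ : Perm β) (r : γ → β) :
    Equivalence (fun y z => σ.SameCycle (r y) (r z)) :=
  ⟨fun _ => Perm.SameCycle.refl σ _, fun h => h.symm, fun h g => h.trans g⟩

lemma sc_step {β : Type} (σ : Perm β) (p : β) : σ.SameCycle p (σ p) := ⟨1, by simp⟩

lemma sc_mem {β : Type} {σ : Perm β} {S : Finset β} (h : ∀ x, σ x ∈ S ↔ x ∈ S) {p q : β}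
    (hpq : σ.SameCycle p q) : p ∈ S ↔ q ∈ S :=
  sc_of_step (fun p q => p ∈ S ↔ q ∈ S) ⟨fun _ => Iff.rfl, fun h => h.symm, fun h g => h.trans g⟩
    (fun p => (h p).symm) hpq

/-- sign of the restriction of `U` to `S`, or zero if `S` is not preserved. -/
def rS (S : Finset α) (U : Perm α) : ℤ :=
  if h : ∀ x, U x ∈ S ↔ x ∈ S then ((Perm.sign (U.subtypePerm h : Perm {x // x ∈ S}) : ℤˣ) : ℤ)
  else 0

lemma rS_mul_right (S : Finset α) (A B : Perm α) (hB : ∀ x, B x ∈ S ↔ x ∈ S) :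
    rS S (A * B) = rS S A * rS S B := by
  have key : (∀ x, (A * B) x ∈ S ↔ x ∈ S) ↔ (∀ x, A x ∈ S ↔ x ∈ S) := by
    constructor
    · intro h x
      have := h (B⁻¹ x)
      have h2 := hB (B⁻¹ x)
      have h3 : B (B⁻¹ x) = x := by simp
      rw [Perm.mul_apply, h3] at this
      rw [h3] at h2
      exact this.trans h2.symm
    · intro h x
      exact (h _).trans (hB x)
  unfold rS
  by_cases hA : ∀ x, A x ∈ S ↔ x ∈ S
  · rw [dif_pos (key.2 hA), dif_pos hA, dif_pos hB, ← Units.val_mul, ← Perm.sign_mul,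
      Perm.subtypePerm_mul]
  · rw [dif_neg (fun h => hA (key.1 h)), dif_neg hA, zero_mul]

lemma rS_mul_left (S : Finset α) (A B : Perm α) (hA : ∀ x, A x ∈ S ↔ x ∈ S) :
    rS S (A * B) = rS S A * rS S B := by
  by_cases hB : ∀ x, B x ∈ S ↔ x ∈ S
  · exact rS_mul_right S A B hB
  · have : ¬ (∀ x, (A * B) x ∈ S ↔ x ∈ S) := fun h => hB fun x => (hA _).symm.trans (h x)
    unfold rS
    rw [dif_neg this, dif_neg hB, mul_zero]

lemma swap_pres_in {S : Finset α} {i j : α} (h : i ∈ S ↔ j ∈ S) (x : α) :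
    swap i j x ∈ S ↔ x ∈ S := by
  rcases eq_or_ne x i with rfl | h1
  · simp [h]
  · rcases eq_or_ne x j with rfl | h2
    · simp [h]
    · rw [swap_apply_of_ne_of_ne h1 h2]

lemma rS_swap_in {S : Finset α} {i j : α} (hi : i ∈ S) (hj : j ∈ S) (hij : i ≠ j) :
    rS S (swap i j) = -1 := by
  unfold rS
  rw [dif_pos (swap_pres_in (by simp [hi, hj])), ← Perm.sign_ofSubtype, Perm.ofSubtype_subtypePerm]
  · simp [Perm.sign_swap hij]
  · intro x hx
    by_contra hxS
    exact hx (swap_apply_of_ne_of_ne (fun h => hxS (h ▸ hi)) (fun h => hxS (h ▸ hj)))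

lemma rS_fix {S : Finset α} {U : Perm α} (h : ∀ x ∈ S, U x = x) : rS S U = 1 := by
  have hp : ∀ x, U x ∈ S ↔ x ∈ S := by
    intro x
    constructor
    · intro hx
      have := h _ hx
      rw [U.injective.eq_iff] at this
      rwa [this] at hx
    · intro hx; rwa [h x hx]
  unfold rS
  rw [dif_pos hp]
  have : (U.subtypePerm hp : Perm {x // x ∈ S}) = 1 := by
    ext x
    simp [h x.1 x.2]
  rw [this]; simp

lemma rS_swap_out {S : Finset α} {i j : α} (hi : i ∉ S) (hj : j ∉ S) :
    rS S (swap i j) = 1 :=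
  rS_fix fun x hx => swap_apply_of_ne_of_ne (fun h => hi (h ▸ hx)) (fun h => hj (h ▸ hx))

lemma rS_union {S : Finset α} {U : Perm α} {q : α} (h : ∀ x, U x ∈ S ↔ x ∈ S) (hq : q ∉ S) :
    (∀ x, U x ∈ S ∪ univ.filter (U.SameCycle q) ↔ x ∈ S ∪ univ.filter (U.SameCycle q)) ∧
    Disjoint S (univ.filter (U.SameCycle q)) ∧
    rS (S ∪ univ.filter (U.SameCycle q)) U =
      -(-1) ^ (univ.filter (U.SameCycle q)).card * rS S U := by
  set C := univ.filter (U.SameCycle q) with hC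
  have hCi : ∀ x, U x ∈ C ↔ x ∈ C := by
    intro x; simp [hC]
  have hu : ∀ x, U x ∈ S ∪ C ↔ x ∈ S ∪ C := by
    intro x; rw [mem_union, mem_union, h, hCi]
  have hd : ∀ x, x ∈ C → x ∉ S := by
    intro x hx hxS
    exact hq ((sc_mem h (mem_filter.1 hx).2).2 hxS)
  refine ⟨hu, ?_, ?_⟩
  · rw [Finset.disjoint_left]
    intro x hx hxC
    exact hd x hxC hx
  unfold rS
  rw [dif_pos h, dif_pos hu, ← Perm.sign_ofSubtype, ← Perm.sign_ofSubtype (Perm.subtypePerm U h)]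
  have key : Perm.ofSubtype (U.subtypePerm hu : Perm {x // x ∈ S ∪ C}) =
      U.cycleOf q * Perm.ofSubtype (U.subtypePerm h : Perm {x // x ∈ S}) := by
    ext y
    rw [Perm.mul_apply]
    by_cases hy : y ∈ S
    · rw [Perm.ofSubtype_apply_of_mem _ (show y ∈ S ∪ C from mem_union_left _ hy),
        Perm.ofSubtype_apply_of_mem _ hy]
      simp only [Perm.subtypePerm_apply]
      rw [Perm.cycleOf_apply_of_not_sameCycle]
      intro hc
      exact hd (U y) (by simpa [hC] using hc) ((h y).2 hy)
    · rw [Perm.ofSubtype_apply_of_not_mem _ hy]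
      by_cases hyC : y ∈ C
      · rw [Perm.ofSubtype_apply_of_mem _ (show y ∈ S ∪ C from mem_union_right _ hyC)]
        simp only [Perm.subtypePerm_apply]
        rw [Perm.SameCycle.cycleOf_apply (mem_filter.1 hyC).2]
      · rw [Perm.ofSubtype_apply_of_not_mem, Perm.cycleOf_apply_of_not_sameCycle]
        · intro hc; exact hyC (by simpa [hC] using hc)
        · simp [hy, hyC]
  rw [key, Perm.sign_mul, Units.val_mul]
  congr 1
  by_cases hf : U q = q
  · have h1 : U.cycleOf q = 1 := by rwa [Perm.cycleOf_eq_one_iff]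
    have h2 : C = {q} := by
      ext y
      simp only [hC, mem_filter, mem_univ, true_and, mem_singleton]
      constructor
      · intro hs
        exact (hs.eq_of_left hf).symm
      · rintro rfl; exact Perm.SameCycle.refl _ _
    rw [h1, h2]; simp
  · have h2 : (U.cycleOf q).support = C := by
      ext y
      rw [Perm.mem_support_cycleOf_iff' hf]
      simp [hC]
    rw [(Perm.isCycle_cycleOf U hf).sign, h2]
    simp

lemma rS_ne {S : Finset α} {U : Perm α} (h : rS S U ≠ 0) : ∀ x, U x ∈ S ↔ x ∈ S := by
  by_contra hc
  exact h (by unfold rS; rw [dif_neg hc])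

lemma full_indicator (p : α) (U : Perm α) :
    ∑ S ∈ ({p}ᶜ : Finset α).powerset, (-1 : ℤ) ^ S.card * rS S U = if Full U then 1 else 0 := by
  split_ifs with hU
  · rw [Finset.sum_eq_single ∅]
    · rw [rS_fix (by simp)]; simp
    · intro S hS hne
      obtain ⟨q, hq⟩ := Finset.nonempty_iff_ne_empty.2 hne
      have hp : p ∉ S := fun hp => by simpa using (mem_powerset.1 hS) hp
      by_contra hc
      have := rS_ne (right_ne_zero_of_mul hc)
      exact hp ((sc_mem this (hU q p)).1 hq)
    · simp
  · obtain ⟨q, hq⟩ : ∃ q, ¬ U.SameCycle q p := by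
      by_contra hc
      push Not at hc
      exact hU fun x y => (hc x).trans (hc y).symm
    set C := univ.filter (U.SameCycle q) with hC
    have hpC : p ∉ C := by simpa [hC] using hq
    have hqC : q ∈ C := by simp [hC, Perm.SameCycle.refl]
    have hCi : ∀ x, U x ∈ C ↔ x ∈ C := by
      intro x; simp [hC]
    rw [← Finset.sum_filter_of_ne (p := fun S => ∀ x, U x ∈ S ↔ x ∈ S)
      (fun S _ h => rS_ne (right_ne_zero_of_mul h))]
    have hinv : ∀ S : Finset α, (∀ x, U x ∈ S ↔ x ∈ S) → q ∈ S → C ⊆ S := by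
      intro S hS hqS x hx
      exact (sc_mem hS (mem_filter.1 hx).2).1 hqS
    have hbase : ∀ S : Finset α, (∀ x, U x ∈ S ↔ x ∈ S) → q ∉ S →
        symmDiff S C = S ∪ C ∧
        (-1 : ℤ) ^ S.card * rS S U + (-1 : ℤ) ^ (symmDiff S C).card * rS (symmDiff S C) U = 0 := by
      intro S hS hqS
      obtain ⟨h1, h2, h3⟩ := rS_union hS hqS
      rw [← hC] at h1 h2 h3
      have h4 : symmDiff S C = S ∪ C := by
        rw [Disjoint.symmDiff_eq_sup h2, Finset.sup_eq_union]
      refine ⟨h4, ?_⟩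
      rw [h4, h3, card_union_of_disjoint h2, pow_add]
      have : ((-1 : ℤ) ^ C.card) * (-1) ^ C.card = 1 := by
        rw [← mul_pow]; simp
      linear_combination (-(-1 : ℤ) ^ S.card * rS S U) * this
    have hsinv : ∀ S : Finset α, (∀ x, U x ∈ S ↔ x ∈ S) →
        ∀ x, U x ∈ symmDiff S C ↔ x ∈ symmDiff S C := by
      intro S hS x
      rw [mem_symmDiff, mem_symmDiff, hS, hCi]
    refine Finset.sum_involution (fun S _ => symmDiff S C) ?_ ?_ ?_ ?_
    · intro S hS
      have hS := (mem_filter.1 hS).2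
      by_cases hqS : q ∈ S
      · have := (hbase (symmDiff S C) (hsinv S hS) (by simp [mem_symmDiff, hqS, hqC])).2
        rw [symmDiff_symmDiff_cancel_right] at this
        linarith
      · exact (hbase S hS hqS).2
    · intro S hS _ he
      rw [symmDiff_eq_left] at he
      rw [he] at hqC
      simp at hqC
    · intro S hS
      obtain ⟨h1, h2⟩ := mem_filter.1 hS
      refine mem_filter.2 ⟨?_, hsinv S h2⟩
      rw [mem_powerset] at h1 ⊢
      intro x hx
      rw [mem_symmDiff] at hx
      rcases hx with hx | hx
      · exact h1 hx.1
      · simp only [mem_compl, mem_singleton]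
        rintro rfl
        exact hpC hx.1
    · intro S hS
      simp

lemma alm_full {x a : α} {V : Perm α} (hA : Alm x V) (hax : a ≠ x) : Full (V * swap a x) := by
  set W := V * swap a x with hW
  have h1 : W a = x := by simp [hW, hA.1]
  have h2 : W x = V a := by simp [hW]
  have h3 : ∀ y, y ≠ a → y ≠ x → W y = V y := by
    intro y hy hy'
    simp [hW, swap_apply_of_ne_of_ne hy hy']
  have hstep : ∀ p, W.SameCycle p (V p) := by
    intro p
    rcases eq_or_ne p x with rfl | hpx
    · rw [hA.1]
    · rcases eq_or_ne p a with rfl | hpa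
      · have e1 := sc_step W p
        rw [h1] at e1
        have e2 := sc_step W x
        rw [h2] at e2
        exact e1.trans e2
      · rw [← h3 p hpa hpx]; exact sc_step W p
  have hax' : W.SameCycle a x := by
    have e1 := sc_step W a
    rwa [h1] at e1
  have hall : ∀ y, W.SameCycle a y := by
    intro y
    rcases eq_or_ne y x with rfl | hy
    · exact hax'
    · exact sc_of_step _ (sc_equiv W) hstep (hA.2 a y hax hy)
  exact fun y z => (hall y).symm.trans (hall z)

lemma full_alm {b : α} {W : Perm α} (hF : Full W) (hb : W b ≠ b) :
    Alm (W b) (W * swap b (W b)) := by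
  set c := W b with hc
  set V := W * swap b c with hV
  have h1 : V c = c := by simp [hV, hc]
  have h2 : V b = W c := by simp [hV]
  have h3 : ∀ y, y ≠ b → y ≠ c → V y = W y := by
    intro y hy hy'
    simp [hV, swap_apply_of_ne_of_ne hy hy']
  refine ⟨h1, ?_⟩
  let r : α → α := fun y => if y = c then b else y
  have hr : ∀ y, y ≠ c → r y = y := fun y hy => if_neg hy
  have hrc : r c = b := if_pos rfl
  have hWc : ∀ p, p ≠ b → W p ≠ c := by
    intro p hp h
    rw [hc] at h
    exact hp (W.injective h)
  have hstep : ∀ p, V.SameCycle (r p) (r (W p)) := by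
    intro p
    rcases eq_or_ne p b with rfl | hpb
    · rw [← hc, hrc, hr _ (Ne.symm hb)]
    · rw [hr (W p) (hWc p hpb)]
      rcases eq_or_ne p c with rfl | hpc
      · rw [hrc, ← h2]; exact sc_step V _
      · rw [hr p hpc, ← h3 p hpb hpc]; exact sc_step V _
  intro y z hy hz
  have := sc_of_step _ (sc_equiv' V r) hstep (hF y z)
  simpa only [hr y hy, hr z hz] using this

lemma step_lemma {β V : Perm α} {S : Finset α} {x a b : α} (hA : Alm x V) (ha : a ∈ S)
    (hb : b ∉ S) (hS : ∀ z, β z ∈ S ↔ (z ∈ S ∧ z ≠ a) ∨ z = b)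
    (hV : ∀ y, β (V y) ∈ S ↔ y ∈ S) (hx : x ∈ S) (hc : ∃ c, c ∉ S ∧ c ≠ b) :
    V b ∉ S ∧ V b ≠ b ∧ x ≠ a ∧ Alm (V b) (V * swap a x * swap b (V b)) := by
  have hbx : b ≠ x := fun h => hb (h ▸ hx)
  have hba : b ≠ a := fun h => hb (h ▸ ha)
  have hnb : ¬ β (V b) ∈ S := fun h => hb ((hV b).1 h)
  rw [hS] at hnb
  have h2 : V b ≠ b := fun h => hnb (Or.inr h)
  have h1 : V b ∉ S := by
    intro h
    have hVb : V b = a := by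
      by_contra hne
      exact hnb (Or.inl ⟨h, hne⟩)
    obtain ⟨c, hcS, hcb⟩ := hc
    have hcx : c ≠ x := fun h => hcS (h ▸ hx)
    have hD : ∀ y, V y ∈ (Sᶜ.erase b) ↔ y ∈ Sᶜ.erase b := by
      intro y
      simp only [mem_erase, mem_compl]
      have e1 := hV y
      rw [hS] at e1
      have e2 : V y = a → y = b := fun h => V.injective (h.trans hVb.symm)
      constructor
      · rintro ⟨h3, h4⟩
        refine ⟨?_, ?_⟩
        · rintro rfl
          exact h4 h
        · tauto
      · rintro ⟨h3, h4⟩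
        tauto
    have := (sc_mem hD (hA.2 c b hcx hbx)).1 (by simp [hcS, hcb])
    simp at this
  have h3 : x ≠ a := by
    have := (hV x).2 hx
    rw [hA.1, hS] at this
    rcases this with h | h
    · exact h.2
    · exact absurd h.symm hbx
  refine ⟨h1, h2, h3, ?_⟩
  have hF := alm_full hA (Ne.symm h3)
  have hWb : (V * swap a x) b = V b := by
    simp [swap_apply_of_ne_of_ne hba hbx]
  have := full_alm (b := b) hF (by rw [hWb]; exact h2)
  rwa [hWb] at this

/-- almost full cycles together with their fixed point -/
def PA (α : Type) [Fintype α] [DecidableEq α] : Finset (α × Perm α) :=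
  univ.filter fun q => Alm q.1 q.2

lemma full_conj {β : Type} (τ V : Perm β) : Full (τ * V * τ⁻¹) ↔ Full V := by
  constructor
  · intro h x y
    have := h (τ x) (τ y)
    rw [Perm.sameCycle_conj] at this
    simpa using this
  · intro h x y
    rw [Perm.sameCycle_conj]; exact h _ _

lemma alm_conj {β : Type} {τ V : Perm β} {x : β} (h : Alm x V) : Alm (τ x) (τ * V * τ⁻¹) := by
  refine ⟨by simp [h.1], ?_⟩
  intro y z hy hz
  rw [Perm.sameCycle_conj]
  refine h.2 _ _ ?_ ?_
  · rintro rfl; simp at hy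
  · rintro rfl; simp at hz

lemma vanish_II {β : Perm α} {S : Finset α} {a b : α} (ha : a ∈ S)
    (hb : b ∉ S) (hS : ∀ z, β z ∈ S ↔ (z ∈ S ∧ z ≠ a) ∨ z = b)
    (hd : ∃ d, d ∈ S ∧ d ≠ a) (hc : ∃ c, c ∉ S ∧ c ≠ b) :
    ∑ q ∈ PA α, rS S (β * q.2) = 0 := by
  rw [← Finset.sum_filter_of_ne (p := fun q : α × Perm α => ∀ x, (β * q.2) x ∈ S ↔ x ∈ S)
      (fun q _ h => rS_ne h)]
  have hba : b ≠ a := fun h => hb (h ▸ ha)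
  have hS2 : ∀ z, β z ∈ Sᶜ ↔ (z ∈ Sᶜ ∧ z ≠ b) ∨ z = a := by
    intro z
    rw [mem_compl, hS, mem_compl]
    by_cases h1 : z = a
    · subst h1; simp [hba.symm]
    · simp [h1]
  have c1 : ∀ q ∈ (PA α).filter (fun q : α × Perm α => ∀ x, (β * q.2) x ∈ S ↔ x ∈ S),
      q.1 ∈ S → q.2 b ∉ S ∧ q.2 b ≠ b ∧ q.1 ≠ a ∧
        Alm (q.2 b) (q.2 * swap a q.1 * swap b (q.2 b)) := by
    intro q hq hx
    obtain ⟨h1, h2⟩ := mem_filter.1 hq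
    exact step_lemma (mem_filter.1 h1).2 ha hb hS (fun y => h2 y) hx hc
  have c2 : ∀ q ∈ (PA α).filter (fun q : α × Perm α => ∀ x, (β * q.2) x ∈ S ↔ x ∈ S),
      q.1 ∉ S → q.2 a ∈ S ∧ q.2 a ≠ a ∧ q.1 ≠ b ∧
        Alm (q.2 a) (q.2 * swap b q.1 * swap a (q.2 a)) := by
    intro q hq hx
    obtain ⟨h1, h2⟩ := mem_filter.1 hq
    have := step_lemma (S := Sᶜ) (β := β) (mem_filter.1 h1).2 (by simpa using hb) (by simpa using ha)
      hS2 (fun y => by simpa using not_congr (h2 y)) (by simpa using hx) (by simpa using hd)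
    simpa using this
  refine Finset.sum_involution (fun q _ => if q.1 ∈ S then
    (q.2 b, q.2 * swap a q.1 * swap b (q.2 b)) else (q.2 a, q.2 * swap b q.1 * swap a (q.2 a)))
    ?_ ?_ ?_ ?_
  · intro q hq
    split_ifs with hx
    · obtain ⟨h1, h2, h3, h4⟩ := c1 q hq hx
      dsimp only
      rw [← mul_assoc, ← mul_assoc, rS_mul_right _ _ _ (swap_pres_in (by simp [hb, h1])),
        rS_mul_right _ _ _ (swap_pres_in (by simp [ha, hx])), rS_swap_out hb h1,
        rS_swap_in ha hx h3.symm]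
      ring
    · obtain ⟨h1, h2, h3, h4⟩ := c2 q hq hx
      dsimp only
      rw [← mul_assoc, ← mul_assoc, rS_mul_right _ _ _ (swap_pres_in (by simp [ha, h1])),
        rS_mul_right _ _ _ (swap_pres_in (by simp [hb, hx])), rS_swap_out hb hx,
        rS_swap_in ha h1 h2.symm]
      ring
  · intro q hq _ he
    split_ifs at he with hx
    · have := (c1 q hq hx).1
      rw [← he] at hx
      exact this hx
    · have := (c2 q hq hx).1
      rw [← he] at hx
      exact hx this
  · intro q hq
    have h0 := (mem_filter.1 hq).2
    split_ifs with hx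
    · obtain ⟨h1, h2, h3, h4⟩ := c1 q hq hx
      refine mem_filter.2 ⟨mem_filter.2 ⟨mem_univ _, h4⟩, ?_⟩
      intro x
      have := h0 (swap a q.1 (swap b (q.2 b) x))
      rw [swap_pres_in (by simp [ha, hx]), swap_pres_in (by simp [hb, h1])] at this
      exact this
    · obtain ⟨h1, h2, h3, h4⟩ := c2 q hq hx
      refine mem_filter.2 ⟨mem_filter.2 ⟨mem_univ _, h4⟩, ?_⟩
      intro x
      have := h0 (swap b q.1 (swap a (q.2 a) x))
      rw [swap_pres_in (by simp [hb, hx]), swap_pres_in (by simp [ha, h1])] at this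
      exact this
  · intro q hq
    have hA := (mem_filter.1 (mem_filter.1 hq).1).2
    by_cases hx : q.1 ∈ S
    · obtain ⟨h1, h2, h3, h4⟩ := c1 q hq hx
      rw [if_pos hx]
      dsimp only
      rw [if_neg h1]
      have e : (q.2 * swap a q.1 * swap b (q.2 b)) a = q.1 := by
        rw [Perm.mul_apply, swap_apply_of_ne_of_ne hba.symm (fun h : a = q.2 b => h1 (h ▸ ha))]
        simp [hA.1]
      rw [e]
      simp [mul_assoc]
    · obtain ⟨h1, h2, h3, h4⟩ := c2 q hq hx
      rw [if_neg hx]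
      dsimp only
      rw [if_pos h1]
      have e : (q.2 * swap b q.1 * swap a (q.2 a)) b = q.1 := by
        rw [Perm.mul_apply, swap_apply_of_ne_of_ne hba (fun h : b = q.2 a => hb (h ▸ h1))]
        simp [hA.1]
      rw [e]
      simp [mul_assoc]

lemma vanish_I {β : Perm α} {S : Finset α} {i j : α} (hi : i ∉ S) (hj : j ∉ S) (hij : i ≠ j)
    (hi' : β i ∈ S) (hj' : β j ∈ S) : ∑ q ∈ PA α, rS S (β * q.2) = 0 := by
  have key : ∀ V : Perm α, rS S (β * (swap i j * V * swap i j)) = - rS S (β * V) := by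
    intro V
    have : β * (swap i j * V * swap i j) = swap (β i) (β j) * ((β * V) * swap i j) := by
      rw [mul_assoc (swap i j), ← mul_assoc β, Equiv.mul_swap_eq_swap_mul]
      simp only [mul_assoc]
    rw [this, rS_mul_left _ _ _ (swap_pres_in (by simp [hi', hj'])),
      rS_mul_right _ _ _ (swap_pres_in (by simp [hi, hj])), rS_swap_out hi hj,
      rS_swap_in hi' hj' (fun h => hij (β.injective h))]
    ring
  have hsum : ∑ q ∈ PA α, rS S (β * q.2) = ∑ q ∈ PA α, rS S (β * (swap i j * q.2 * swap i j)) := by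
    have hmem : ∀ q ∈ PA α, ((swap i j q.1, swap i j * q.2 * swap i j) : α × Perm α) ∈ PA α := by
      intro q hq
      have := alm_conj (τ := swap i j) (mem_filter.1 hq).2
      rw [swap_inv] at this
      exact mem_filter.2 ⟨mem_univ _, this⟩
    refine Finset.sum_bij' (fun q _ => (swap i j q.1, swap i j * q.2 * swap i j))
      (fun q _ => (swap i j q.1, swap i j * q.2 * swap i j)) hmem hmem ?_ ?_ ?_
    · intro q _; simp [mul_assoc]
    · intro q _; simp [mul_assoc]
    · intro q _; simp [mul_assoc]
  simp only [key, Finset.sum_neg_distrib] at hsum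
  linarith

lemma vanish {β : Perm α} {S : Finset α} (h2 : 2 ≤ S.card) (h3 : S.card + 2 ≤ Fintype.card α) :
    ∑ q ∈ PA α, rS S (β * q.2) = 0 := by
  have hd : ∀ a, ∃ d, d ∈ S ∧ d ≠ a := by
    intro a
    obtain ⟨d, hd, hda⟩ := Finset.exists_mem_ne (by omega : 1 < S.card) a
    exact ⟨d, hd, hda⟩
  have hc : ∀ a, ∃ d, d ∉ S ∧ d ≠ a := by
    intro a
    have : 1 < Sᶜ.card := by rw [card_compl]; omega
    obtain ⟨d, hd, hda⟩ := Finset.exists_mem_ne this a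
    exact ⟨d, mem_compl.1 hd, hda⟩
  set S' := univ.filter (fun z => β z ∈ S) with hS'
  have hmem : ∀ z, z ∈ S' ↔ β z ∈ S := by intro z; simp [hS']
  have hcard : S'.card = S.card := by
    have : S'.image β = S := by
      ext y
      simp only [mem_image, hmem]
      constructor
      · rintro ⟨z, hz, rfl⟩; exact hz
      · intro hy; exact ⟨β⁻¹ y, by simpa using hy, by simp⟩
    rw [← this, card_image_of_injective _ β.injective]
  have e1 := Finset.card_sdiff_add_card_inter S' S
  have e2 := Finset.card_sdiff_add_card_inter S S'
  rw [inter_comm] at e2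
  have hE : (S' \ S).card = (S \ S').card := by omega
  rcases Nat.lt_or_ge (S' \ S).card 2 with hlt | hge
  · rcases Nat.lt_or_ge (S' \ S).card 1 with hlt' | hge'
    · have hz : S' \ S = ∅ := by rw [← card_eq_zero]; omega
      have hz' : S \ S' = ∅ := by rw [← card_eq_zero]; omega
      have hSS : S' = S := by
        apply Subset.antisymm
        · rwa [← sdiff_eq_empty_iff_subset]
        · rwa [← sdiff_eq_empty_iff_subset]
      apply Finset.sum_eq_zero
      intro q hq
      have hA := (mem_filter.1 hq).2
      by_contra hne
      have hinv := rS_ne hne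
      obtain ⟨d, hd1, hd2⟩ := hd q.1
      obtain ⟨c, hc1, hc2⟩ := hc q.1
      have hV : ∀ x, q.2 x ∈ S ↔ x ∈ S := by
        intro x
        rw [← hinv x, Perm.mul_apply, ← hmem, hSS]
      exact hc1 ((sc_mem hV (hA.2 d c hd2 hc2)).1 hd1)
    · obtain ⟨b, hb⟩ := card_eq_one.1 (by omega : (S' \ S).card = 1)
      obtain ⟨a, ha⟩ := card_eq_one.1 (by omega : (S \ S').card = 1)
      have hb1 : ∀ z, (z ∈ S' ∧ z ∉ S) ↔ z = b := by
        intro z; rw [← mem_sdiff, hb, mem_singleton]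
      have ha1 : ∀ z, (z ∈ S ∧ z ∉ S') ↔ z = a := by
        intro z; rw [← mem_sdiff, ha, mem_singleton]
      refine vanish_II (a := a) (b := b) ((ha1 a).2 rfl).1 ((hb1 b).2 rfl).2 ?_ (hd a) (hc b)
      intro z
      rw [← hmem, ← hb1 z, Ne, ← ha1 z]
      tauto
  · obtain ⟨i, hi, j, hj, hij⟩ := Finset.one_lt_card.1 (by omega : 1 < (S' \ S).card)
    rw [mem_sdiff, hmem] at hi hj
    exact vanish_I hi.2 hj.2 hij hi.1 hj.1

lemma rS_single (y : α) (U : Perm α) : rS {y} U = if U y = y then 1 else 0 := by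
  split_ifs with h
  · exact rS_fix (by simpa using h)
  · by_contra hne
    have := (rS_ne hne y).2 (by simp)
    exact h (by simpa using this)

lemma rS_compl (p : α) (U : Perm α) :
    rS {p}ᶜ U = if U p = p then ((Perm.sign U : ℤˣ) : ℤ) else 0 := by
  split_ifs with h
  · have hp : ∀ x, U x ∈ ({p}ᶜ : Finset α) ↔ x ∈ ({p}ᶜ : Finset α) := by
      intro x
      simp only [mem_compl, mem_singleton]
      refine not_congr ⟨fun hx => U.injective (hx.trans h.symm), ?_⟩
      rintro rfl; exact h
    unfold rS
    rw [dif_pos hp, ← Perm.sign_ofSubtype, Perm.ofSubtype_subtypePerm]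
    intro x hx
    simp only [mem_compl, mem_singleton]
    rintro rfl; exact hx h
  · by_contra hne
    have := (rS_ne hne p).1
    simp only [mem_compl, mem_singleton] at this
    exact this h trivial

/-- number of almost full cycles with given fixed point -/
def cA (x : α) : ℤ := ((univ.filter (fun V : Perm α => Alm x V)).card : ℤ)

lemma cA_eq (x y : α) : cA x = cA y := by
  unfold cA
  norm_cast
  refine Finset.card_bij' (fun V _ => swap x y * V * (swap x y)⁻¹)
    (fun V _ => swap x y * V * (swap x y)⁻¹) ?_ ?_ ?_ ?_
  · intro V hV
    have := alm_conj (τ := swap x y) (mem_filter.1 hV).2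
    rw [swap_apply_left] at this
    exact mem_filter.2 ⟨mem_univ _, this⟩
  · intro V hV
    have := alm_conj (τ := swap x y) (mem_filter.1 hV).2
    rw [swap_apply_right] at this
    exact mem_filter.2 ⟨mem_univ _, this⟩
  · intro V _; simp [mul_assoc]
  · intro V _; simp [mul_assoc]

lemma card_PA (p : α) : ((PA α).card : ℤ) = Fintype.card α * cA p := by
  have h : (PA α).card = ∑ x : α, (univ.filter (fun V : Perm α => Alm x V)).card := by
    rw [PA, Finset.card_eq_sum_card_fiberwise (f := Prod.fst) (t := univ) (by simp)]
    refine Finset.sum_congr rfl fun x _ => ?_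
    refine Finset.card_bij' (fun q _ => q.2) (fun V _ => (x, V)) ?_ ?_ ?_ ?_
    · rintro ⟨y, V⟩ h
      simp only [mem_filter, mem_univ, true_and] at h ⊢
      obtain ⟨h, rfl⟩ := h
      exact h
    · intro V h
      simpa using h
    · rintro ⟨y, V⟩ h
      simp only [mem_filter, mem_univ, true_and] at h ⊢
      rw [h.2]
    · simp
  rw [h]
  push_cast
  have : ∀ x : α, ((univ.filter (fun V : Perm α => Alm x V)).card : ℤ) = cA p :=
    fun x => cA_eq x p
  simp [this]

lemma alm_moves (h3 : 3 ≤ Fintype.card α) {x y : α} {V : Perm α} (h : Alm x V) (hy : V y = y) :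
    y = x := by
  by_contra hne
  obtain ⟨w, hw⟩ : ∃ w, w ∉ ({x, y} : Finset α) := by
    by_contra hc
    push Not at hc
    have : (univ : Finset α) ⊆ {x, y} := fun w _ => hc w
    have := (card_le_card this).trans card_le_two
    rw [card_univ] at this
    omega
  simp only [mem_insert, mem_singleton, not_or] at hw
  exact hw.2 ((h.2 y w hne hw.1).eq_of_left hy).symm

lemma alm_sign (h3 : 3 ≤ Fintype.card α) {x : α} {V : Perm α} (h : Alm x V) :
    ((Perm.sign V : ℤˣ) : ℤ) = (-1) ^ Fintype.card α := by
  have hs : V.support = {x}ᶜ := by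
    ext y
    simp only [Perm.mem_support, mem_compl, mem_singleton]
    refine not_congr ⟨alm_moves h3 h, ?_⟩
    rintro rfl; exact h.1
  obtain ⟨y, hy⟩ : ({x}ᶜ : Finset α).Nonempty := by
    rw [← card_pos, card_compl, card_singleton]; omega
  have hc : V.IsCycle := by
    refine ⟨y, ?_, ?_⟩
    · rw [← hs] at hy
      exact Perm.mem_support.1 hy
    · intro z hz
      refine h.2 y z (by simpa using hy) ?_
      rintro rfl; exact hz h.1
  rw [hc.sign, hs, card_compl, card_singleton]
  obtain ⟨k, hk⟩ : ∃ k, Fintype.card α = k + 1 := ⟨Fintype.card α - 1, by omega⟩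
  rw [hk]
  simp [pow_succ]

lemma count_move (h3 : 3 ≤ Fintype.card α) (p y z : α) :
    (((PA α).filter (fun q => q.2 y = z)).card : ℤ) = cA p := by
  have hself : (((PA α).filter (fun q => q.2 y = y)).card : ℤ) = cA p := by
    rw [cA_eq p y]
    unfold cA
    norm_cast
    refine Finset.card_bij' (fun q _ => q.2) (fun V _ => (y, V)) ?_ ?_ ?_ ?_
    · rintro ⟨x, V⟩ h
      simp only [PA, mem_filter, mem_univ, true_and] at h ⊢
      rw [alm_moves h3 h.1 h.2]
      exact h.1
    · intro V h
      simp only [PA, mem_filter, mem_univ, true_and] at h ⊢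
      exact ⟨h, h.1⟩
    · rintro ⟨x, V⟩ h
      simp only [PA, mem_filter, mem_univ, true_and] at h ⊢
      rw [alm_moves h3 h.1 h.2]
    · simp
  rcases eq_or_ne z y with rfl | hzy
  · exact hself
  have hconst : ∀ w, w ≠ y → (((PA α).filter (fun q => q.2 y = w)).card : ℤ) =
      ((PA α).filter (fun q => q.2 y = z)).card := by
    intro w hw
    norm_cast
    have hm : ∀ u v : α, u ≠ y → v ≠ y → ∀ q ∈ (PA α).filter (fun q => q.2 y = u),
      ((swap u v q.1, swap u v * q.2 * (swap u v)⁻¹) : α × Perm α) ∈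
        (PA α).filter (fun q => q.2 y = v) := by
      intro u v hu hv q hq
      obtain ⟨h1, h2⟩ := mem_filter.1 hq
      refine mem_filter.2 ⟨mem_filter.2 ⟨mem_univ _, alm_conj (mem_filter.1 h1).2⟩, ?_⟩
      simp [swap_apply_of_ne_of_ne hu.symm hv.symm, h2]
    refine Finset.card_bij' (fun q _ => (swap w z q.1, swap w z * q.2 * (swap w z)⁻¹))
      (fun q _ => (swap z w q.1, swap z w * q.2 * (swap z w)⁻¹)) (hm w z hw hzy) (hm z w hzy hw) ?_ ?_
    · intro q _; simp [mul_assoc, swap_comm z w]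
    · intro q _; simp [mul_assoc, swap_comm z w]
  have htot : ((PA α).card : ℤ) = ∑ w : α, (((PA α).filter (fun q => q.2 y = w)).card : ℤ) := by
    rw [Finset.card_eq_sum_card_fiberwise (f := fun q : α × Perm α => q.2 y) (t := univ) (by simp)]
    push_cast
    rfl
  rw [card_PA p, ← Finset.add_sum_erase _ _ (mem_univ y), hself,
    Finset.sum_congr rfl (fun w hw => hconst w (mem_erase.1 hw).1)] at htot
  simp only [sum_const, card_erase_of_mem (mem_univ y), card_univ, nsmul_eq_mul] at htot
  obtain ⟨k, hk⟩ : ∃ k, Fintype.card α = k + 1 := ⟨Fintype.card α - 1, by omega⟩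
  rw [hk] at htot
  simp only [Nat.add_sub_cancel] at htot
  push_cast at htot
  have hk0 : (k : ℤ) ≠ 0 := by
    norm_cast; omega
  apply mul_left_cancel₀ hk0
  linarith

lemma term_S (h3 : 3 ≤ Fintype.card α) (p : α) (β : Perm α) {S : Finset α}
    (hS : S ∈ ({p}ᶜ : Finset α).powerset) :
    ∑ q ∈ PA α, (-1 : ℤ) ^ S.card * rS S (β * q.2) =
      (if S = ∅ then Fintype.card α * cA p else 0) + (if S.card = 1 then - cA p else 0)
      + (if S = {p}ᶜ then - ((Perm.sign β : ℤˣ) : ℤ) * cA p else 0) := by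
  have hpc : ({p}ᶜ : Finset α).card = Fintype.card α - 1 := by rw [card_compl, card_singleton]
  have hcnt : ∀ y, ∑ q ∈ PA α, (if (β * q.2) y = y then (1 : ℤ) else 0) = cA p := by
    intro y
    rw [← count_move h3 p y (β⁻¹ y), Finset.card_filter]
    push_cast
    refine Finset.sum_congr rfl fun q _ => ?_
    congr 1
    rw [Perm.eq_inv_iff_eq]; rfl
  rw [mem_powerset] at hS
  have hle := card_le_card hS
  rw [hpc] at hle
  by_cases h0 : S = ∅
  · subst h0
    have hne : (∅ : Finset α) ≠ {p}ᶜ := by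
      intro h
      rw [← h, card_empty] at hpc
      omega
    rw [if_pos rfl, if_neg (by simp), if_neg hne]
    have : ∀ q ∈ PA α, (-1 : ℤ) ^ (∅ : Finset α).card * rS ∅ (β * q.2) = 1 := by
      intro q _
      rw [rS_fix (by simp)]; simp
    rw [Finset.sum_congr rfl this, sum_const, nsmul_eq_mul, card_PA p]
    ring
  rw [if_neg h0]
  by_cases h1 : S.card = 1
  · have hne : S ≠ {p}ᶜ := by
      intro h
      rw [h] at h1
      omega
    rw [if_pos h1, if_neg hne, h1]
    obtain ⟨y, rfl⟩ := card_eq_one.1 h1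
    simp only [rS_single]
    rw [← Finset.mul_sum, hcnt]
    ring
  rw [if_neg h1]
  by_cases h2 : S = {p}ᶜ
  · rw [if_pos h2, h2, hpc]
    have : ∀ q ∈ PA α, (-1 : ℤ) ^ (Fintype.card α - 1) * rS {p}ᶜ (β * q.2) =
        - ((Perm.sign β : ℤˣ) : ℤ) * (if (β * q.2) p = p then (1 : ℤ) else 0) := by
      intro q hq
      rw [rS_compl]
      split_ifs
      · rw [Perm.sign_mul, Units.val_mul, alm_sign h3 (mem_filter.1 hq).2]
        obtain ⟨k, hk⟩ : ∃ k, Fintype.card α = k + 1 := ⟨Fintype.card α - 1, by omega⟩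
        rw [hk, Nat.add_sub_cancel, pow_succ]
        have : ((-1 : ℤ) ^ k) * (-1) ^ k = 1 := by
          rw [← mul_pow]; simp
        linear_combination (-((Perm.sign β : ℤˣ) : ℤ)) * this
      · simp
    rw [Finset.sum_congr rfl this, ← Finset.mul_sum, hcnt]
    ring
  rw [if_neg h2, ← Finset.mul_sum, vanish]
  · ring
  · have : S.card ≠ 0 := by rwa [Ne, card_eq_zero]
    omega
  · have : S.card < ({p}ᶜ : Finset α).card := card_lt_card (hS.ssubset_of_ne h2)
    omega

theorem fact_count (h3 : 3 ≤ Fintype.card α) (p : α) (β : Perm α) :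
    ∑ q ∈ PA α, (if Full (β * q.2) then (1 : ℤ) else 0) =
      cA p * (1 - ((Perm.sign β : ℤˣ) : ℤ)) := by
  simp only [← full_indicator p]
  rw [Finset.sum_comm, Finset.sum_congr rfl (fun S hS => term_S h3 p β hS),
    Finset.sum_add_distrib, Finset.sum_add_distrib]
  have hpc : ({p}ᶜ : Finset α).card = Fintype.card α - 1 := by rw [card_compl, card_singleton]
  have e1 : ∑ S ∈ ({p}ᶜ : Finset α).powerset, (if S = ∅ then Fintype.card α * cA p else 0) =
      Fintype.card α * cA p := by
    rw [Finset.sum_ite_eq']; simp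
  have e3 : ∑ S ∈ ({p}ᶜ : Finset α).powerset,
      (if S = {p}ᶜ then - ((Perm.sign β : ℤˣ) : ℤ) * cA p else 0) =
      - ((Perm.sign β : ℤˣ) : ℤ) * cA p := by
    rw [Finset.sum_ite_eq']; simp
  have e2 : ∑ S ∈ ({p}ᶜ : Finset α).powerset, (if S.card = 1 then - cA p else 0) =
      ((Fintype.card α : ℤ) - 1) * (- cA p) := by
    rw [← Finset.sum_filter, ← Finset.powersetCard_eq_filter, sum_const, card_powersetCard, hpc,
      Nat.choose_one_right, nsmul_eq_mul, Nat.cast_sub (by omega)]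
    simp
  rw [e1, e2, e3]
  ring

lemma sep_conj {τ V : Perm α} {M : Finset α} : Sep (M.image τ) (τ * V * τ⁻¹) ↔ Sep M V := by
  unfold Sep
  simp only [Perm.sameCycle_conj, forall_mem_image]
  simp [τ.injective.eq_iff]

lemma alm_conj_iff {τ V : Perm α} {x : α} : Alm (τ x) (τ * V * τ⁻¹) ↔ Alm x V := by
  refine ⟨fun h => ?_, alm_conj⟩
  have := alm_conj (τ := τ⁻¹) h
  simpa [mul_assoc] using this

/-- pairs of full cycles whose product separates `M` -/
def T (M : Finset α) : ℤ :=
  ∑ v : Perm α, ∑ u : Perm α, if Full v ∧ Full u ∧ Sep M (u * v) then 1 else 0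

/-- pairs (almost full cycle fixing `x`, full cycle) whose product separates `M` -/
def G (x : α) (M : Finset α) : ℤ :=
  ∑ v : Perm α, ∑ u : Perm α, if Alm x v ∧ Full u ∧ Sep M (u * v) then 1 else 0

lemma T_conj (τ : Perm α) (M : Finset α) : T (M.image τ) = T M := by
  unfold T
  rw [← (MulAut.conj τ).toEquiv.sum_comp]
  refine Finset.sum_congr rfl fun v _ => ?_
  rw [← (MulAut.conj τ).toEquiv.sum_comp]
  refine Finset.sum_congr rfl fun u _ => ?_
  have : (τ * u * τ⁻¹) * (τ * v * τ⁻¹) = τ * (u * v) * τ⁻¹ := by group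
  simp only [MulEquiv.toEquiv_eq_coe, MulEquiv.coe_toEquiv, MulAut.conj_apply, this, sep_conj,
    full_conj]

lemma G_conj (τ : Perm α) (x : α) (M : Finset α) : G (τ x) (M.image τ) = G x M := by
  unfold G
  rw [← (MulAut.conj τ).toEquiv.sum_comp]
  refine Finset.sum_congr rfl fun v _ => ?_
  rw [← (MulAut.conj τ).toEquiv.sum_comp]
  refine Finset.sum_congr rfl fun u _ => ?_
  have : (τ * u * τ⁻¹) * (τ * v * τ⁻¹) = τ * (u * v) * τ⁻¹ := by group
  simp only [MulEquiv.toEquiv_eq_coe, MulEquiv.coe_toEquiv, MulAut.conj_apply, this, sep_conj,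
    full_conj, alm_conj_iff]

lemma T_card {M M' : Finset α} (h : M.card = M'.card) : T M = T M' := by
  have e : {x // x ∈ M} ≃ {x // x ∈ M'} := Finset.equivOfCardEq h
  have : M.image e.extendSubtype = M' := by
    apply Finset.eq_of_subset_of_card_le
    · intro y hy
      obtain ⟨x, hx, rfl⟩ := mem_image.1 hy
      exact e.extendSubtype_mem x hx
    · rw [card_image_of_injective _ (Equiv.injective _), h]
  rw [← this, T_conj]

lemma full_inv {β : Type} {V : Perm β} : Full V⁻¹ ↔ Full V := by
  unfold Full; simp only [Perm.sameCycle_inv]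

lemma alm_inv {β : Type} {x : β} {V : Perm β} : Alm x V⁻¹ ↔ Alm x V := by
  unfold Alm
  simp only [Perm.sameCycle_inv]
  rw [Perm.inv_eq_iff_eq, eq_comm]

lemma sum_G (h3 : 3 ≤ Fintype.card α) (p : α) (M : Finset α) :
    ∑ x, G x M = cA p * ∑ β : Perm α, if Sep M β then (1 - ((Perm.sign β : ℤˣ) : ℤ)) else 0 := by
  have h1 : cA p * (∑ β : Perm α, if Sep M β then (1 - ((Perm.sign β : ℤˣ) : ℤ)) else 0) =
      ∑ β : Perm α, ∑ x : α, ∑ v : Perm α,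
        if Alm x v ∧ Full (β * v) ∧ Sep M β then 1 else 0 := by
    rw [Finset.mul_sum]
    refine Finset.sum_congr rfl fun β _ => ?_
    rw [mul_ite, mul_zero, ← fact_count h3 p β, PA, Finset.sum_filter, Fintype.sum_prod_type]
    split_ifs with hs
    · refine Finset.sum_congr rfl fun x _ => Finset.sum_congr rfl fun v _ => ?_
      by_cases ha : Alm x v <;> simp [ha, hs]
    · simp [hs]
  rw [h1, Finset.sum_comm]
  refine Finset.sum_congr rfl fun x _ => ?_
  rw [Finset.sum_comm]
  unfold G
  rw [← Equiv.sum_comp (Equiv.inv (Perm α))]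
  refine Finset.sum_congr rfl fun v _ => ?_
  rw [← Equiv.sum_comp (Equiv.mulRight v)]
  refine Finset.sum_congr rfl fun u _ => ?_
  simp [alm_inv]

end

section opt
open scoped Classical

variable {γ : Type} [Fintype γ] [DecidableEq γ]

/-- insertion of `none` just before `a` -/
def ins (a : γ) (π : Perm γ) : Perm (Option γ) := swap none (some a) * optionCongr π

lemma ins_sc (a : γ) (π : Perm γ) (p q : Option γ) :
    (ins a π).SameCycle p q ↔ π.SameCycle (p.getD a) (q.getD a) := by
  have w0 : ins a π none = some a := by simp [ins]
  have w1 : ∀ y, π y = a → ins a π (some y) = none := by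
    intro y hy; simp [ins, hy]
  have w2 : ∀ y, π y ≠ a → ins a π (some y) = some (π y) := by
    intro y hy
    simp only [ins, Perm.mul_apply, optionCongr_apply, Option.map_some]
    rw [swap_apply_of_ne_of_ne (by simp) (by simpa using hy)]
  constructor
  · intro h
    refine sc_of_step _ (sc_equiv' π (fun p : Option γ => p.getD a)) ?_ h
    intro p
    cases p with
    | none => simp [w0, Perm.SameCycle.refl]
    | some y =>
      by_cases hy : π y = a
      · rw [w1 y hy]
        simp only [Option.getD_some, Option.getD_none]
        rw [← hy]; exact sc_step π y
      · rw [w2 y hy]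
        exact sc_step π y
  · intro h
    have hs : ∀ y z, π.SameCycle y z → (ins a π).SameCycle (some y) (some z) := by
      intro y z hyz
      refine sc_of_step _ (sc_equiv' (ins a π) (fun y : γ => some y)) ?_ hyz
      intro y
      by_cases hy : π y = a
      · have e1 := sc_step (ins a π) (some y)
        have e2 := sc_step (ins a π) none
        rw [w1 y hy] at e1
        rw [w0] at e2
        simp only [hy]
        exact e1.trans e2
      · have e1 := sc_step (ins a π) (some y)
        rwa [w2 y hy] at e1
    have hr : ∀ p : Option γ, (ins a π).SameCycle p (some (p.getD a)) := by
      intro p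
      cases p with
      | none =>
        have e2 := sc_step (ins a π) none
        rwa [w0] at e2
      | some y => exact Perm.SameCycle.refl _ _
    exact (hr p).trans ((hs _ _ h).trans (hr q).symm)

lemma oc_sc (π : Perm γ) (y z : γ) :
    Perm.SameCycle (optionCongr π : Perm (Option γ)) (some y) (some z) ↔ π.SameCycle y z := by
  constructor
  · intro h
    have := sc_of_step _ (sc_equiv' π (fun p : Option γ => p.getD y)) ?_ h
    · simpa using this
    · intro p
      cases p with
      | none => simp [Perm.SameCycle.refl]
      | some y => simp [Perm.SameCycle.refl]
  · intro h
    refine sc_of_step _ (sc_equiv' (optionCongr π : Perm (Option γ)) (fun y : γ => some y)) ?_ h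
    intro y
    exact sc_step (optionCongr π : Perm (Option γ)) (some y)

lemma oc_none_sc (π : Perm γ) (z : γ) :
    ¬ Perm.SameCycle (optionCongr π : Perm (Option γ)) none (some z) := by
  intro h
  have := h.eq_of_left (by simp [Function.IsFixedPt])
  simp at this

lemma alm_oc (π : Perm γ) : Alm none (optionCongr π : Perm (Option γ)) ↔ Full π := by
  constructor
  · intro h y z
    exact (oc_sc π y z).1 (h.2 _ _ (by simp) (by simp))
  · intro h
    refine ⟨by simp, ?_⟩
    intro y z hy hz
    obtain ⟨y, rfl⟩ := Option.ne_none_iff_exists'.1 hy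
    obtain ⟨z, rfl⟩ := Option.ne_none_iff_exists'.1 hz
    exact (oc_sc π y z).2 (h _ _)

lemma full_ins (a : γ) (π : Perm γ) : Full (ins a π) ↔ Full π := by
  constructor
  · intro h y z
    have := (ins_sc a π (some y) (some z)).1 (h _ _)
    simpa using this
  · intro h y z
    exact (ins_sc a π y z).2 (h _ _)

lemma sum_perm_option (F : Perm (Option γ) → ℤ) :
    ∑ U, F U = (∑ π : Perm γ, F (optionCongr π)) + ∑ a : γ, ∑ π : Perm γ, F (ins a π) := by
  rw [← (Equiv.Perm.decomposeOption (α := γ)).symm.sum_comp, Fintype.sum_prod_type,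
    Fintype.sum_option]
  congr 1
  refine Finset.sum_congr rfl fun π _ => ?_
  congr 1
  ext i
  simp

lemma sep_oc (M : Finset γ) (π : Perm γ) :
    Sep (M.image some) (optionCongr π : Perm (Option γ)) ↔ Sep M π := by
  unfold Sep
  simp only [forall_mem_image, oc_sc]
  simp

lemma sep_ins (M : Finset γ) (a : γ) (π : Perm γ) :
    Sep (M.image some) (ins a π) ↔ Sep M π := by
  unfold Sep
  simp only [forall_mem_image, ins_sc]
  simp

lemma sep_ins_none (M : Finset γ) (a : γ) (π : Perm γ) :
    Sep (insert none (M.image some)) (ins a π) ↔ a ∉ M ∧ Sep (insert a M) π := by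
  unfold Sep
  simp only [forall_mem_insert, forall_mem_image, ins_sc]
  simp only [Option.getD_none, Option.getD_some, ne_eq, not_true_eq_false, false_imp_iff, true_and,
    reduceCtorEq, not_false_eq_true, forall_const, Option.some.injEq]
  constructor
  · rintro ⟨h1, h2⟩
    refine ⟨fun ha => h1 ha (Perm.SameCycle.refl _ _), fun y hy _ => h1 hy, ?_⟩
    intro y hy
    exact ⟨fun _ => (h2 hy).1, fun z hz => (h2 hy).2 hz⟩
  · rintro ⟨h0, h1, h2⟩
    refine ⟨fun y hy => h1 y hy ?_, ?_⟩
    · rintro rfl; exact h0 hy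
    · intro y hy
      refine ⟨(h2 y hy).1 ?_, fun z hz => (h2 y hy).2 z hz⟩
      rintro rfl; exact h0 hy

lemma not_full_oc [Nonempty γ] (π : Perm γ) : ¬ Full (optionCongr π : Perm (Option γ)) := by
  intro h
  obtain ⟨z⟩ := ‹Nonempty γ›
  exact oc_none_sc π z (h _ _)

lemma not_alm_ins (a : γ) (π : Perm γ) : ¬ Alm none (ins a π) := by
  intro h
  have := h.1
  simp [ins] at this

lemma G_none [Nonempty γ] (M : Finset (Option γ)) :
    G none M = ∑ a : γ, ∑ v : Perm γ, ∑ u : Perm γ,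
      if Full v ∧ Full u ∧ Sep M (ins a (u * v)) then 1 else 0 := by
  unfold G
  rw [sum_perm_option]
  simp only [not_alm_ins, false_and, if_false, sum_const_zero, add_zero, alm_oc]
  conv_rhs => rw [Finset.sum_comm]
  refine Finset.sum_congr rfl fun v _ => ?_
  rw [sum_perm_option]
  simp only [not_full_oc, false_and, and_false, if_false, sum_const_zero, zero_add, full_ins]
  refine Finset.sum_congr rfl fun a _ => Finset.sum_congr rfl fun u _ => ?_
  have : ins a u * optionCongr v = ins a (u * v) := by
    unfold ins
    rw [mul_assoc]
    congr 1
    ext i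
    cases i <;> simp
  rw [this]

lemma G_none_out [Nonempty γ] (M : Finset γ) :
    G none (M.image some) = Fintype.card γ * T M := by
  rw [G_none]
  simp only [sep_ins]
  rw [sum_const, nsmul_eq_mul, card_univ]
  rfl

lemma G_none_in [Nonempty γ] (M : Finset γ) (t : ℤ) (ht : ∀ a ∉ M, T (insert a M) = t) :
    G none (insert none (M.image some)) = (Fintype.card γ - M.card) * t := by
  rw [G_none]
  simp only [sep_ins_none]
  have : ∀ a : γ, (∑ v : Perm γ, ∑ u : Perm γ,
      if Full v ∧ Full u ∧ a ∉ M ∧ Sep (insert a M) (u * v) then (1 : ℤ) else 0) =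
      if a ∈ Mᶜ then t else 0 := by
    intro a
    by_cases ha : a ∈ M
    · simp [ha]
    · simp only [mem_compl, ha, not_false_eq_true, true_and, if_true]
      exact ht a ha
  simp only [this]
  rw [Finset.sum_ite_mem, univ_inter, sum_const, nsmul_eq_mul, card_compl,
    Nat.cast_sub (card_le_univ M)]

lemma cA_none : cA (none : Option γ) = ((univ.filter (fun v : Perm γ => Full v)).card : ℤ) := by
  unfold cA
  rw [Finset.card_filter, Finset.card_filter]
  push_cast
  rw [sum_perm_option]
  simp only [not_alm_ins, if_false, sum_const_zero, add_zero, alm_oc]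

lemma sum_G_option [Nonempty γ] (M : Finset γ) :
    ∑ x, G x (M.image some) =
      (Fintype.card γ - M.card + 1) * (Fintype.card γ + M.card) * T M := by
  rw [Fintype.sum_option, G_none_out]
  have hsome : ∀ y : γ, G (some y) (M.image some) =
      if y ∈ M then (Fintype.card γ - M.card + 1) * T M else Fintype.card γ * T M := by
    intro y
    have hc := G_conj (swap none (some y)) (some y) (M.image some)
    rw [swap_apply_right] at hc
    rw [← hc]
    split_ifs with hy
    · have : (M.image some).image (swap none (some y)) =
          insert none ((M.erase y).image some) := by
        rw [← insert_erase hy, image_insert, image_insert, swap_apply_right, insert_erase hy]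
        congr 1
        rw [image_image]
        refine image_congr fun z hz => ?_
        have hz := mem_erase.1 hz
        simp [swap_apply_of_ne_of_ne, hz.1]
      rw [this, G_none_in _ (T M)]
      · rw [card_erase_of_mem hy, Nat.cast_sub (card_pos.2 ⟨y, hy⟩)]
        push_cast
        ring
      · intro a ha
        apply T_card
        rw [card_insert_of_notMem ha, card_erase_add_one hy]
    · have : (M.image some).image (swap none (some y)) = M.image some := by
        rw [image_image]
        refine image_congr fun z hz => ?_
        have : z ≠ y := fun h => hy (h ▸ hz)
        simp [swap_apply_of_ne_of_ne, this]
      rw [this, G_none_out]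
  simp only [hsome]
  rw [Finset.sum_ite, sum_const, sum_const]
  have h1 : (univ.filter (fun y => y ∈ M)).card = M.card := by congr 1; ext; simp
  have h2 : (univ.filter (fun y => y ∉ M)).card = Fintype.card γ - M.card := by
    rw [← card_compl]; congr 1; ext; simp
  rw [h1, h2, nsmul_eq_mul, nsmul_eq_mul, Nat.cast_sub (card_le_univ M)]
  ring

end opt

section fin
open scoped Classical

/-- weighted number of permutations separating `M` -/
def Fw (χ : ℤˣ →* ℤˣ) {γ : Type} [Fintype γ] [DecidableEq γ] (M : Finset γ) : ℤ :=
  ∑ π : Perm γ, if Sep M π then ((χ (Perm.sign π) : ℤˣ) : ℤ) else 0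

lemma permCongr_sc {γ δ : Type} (e : γ ≃ δ) (σ : Perm γ) (y z : γ) :
    (e.permCongr σ).SameCycle (e y) (e z) ↔ σ.SameCycle y z := by
  constructor
  · intro h
    have := sc_of_step _ (sc_equiv' σ e.symm) ?_ h
    · simpa using this
    · intro p
      simp [Perm.SameCycle.refl]
  · intro h
    refine sc_of_step _ (sc_equiv' (e.permCongr σ) e) ?_ h
    intro p
    have := sc_step (e.permCongr σ) (e p)
    simpa using this

lemma Fw_equiv (χ : ℤˣ →* ℤˣ) {γ δ : Type} [Fintype γ] [DecidableEq γ] [Fintype δ] [DecidableEq δ]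
    (e : γ ≃ δ) (M : Finset γ) : Fw χ (M.image e) = Fw χ M := by
  unfold Fw
  rw [← Equiv.sum_comp e.permCongr]
  refine Finset.sum_congr rfl fun π _ => ?_
  rw [Perm.sign_permCongr]
  have : Sep (M.image e) (e.permCongr π) ↔ Sep M π := by
    unfold Sep
    simp only [forall_mem_image, permCongr_sc]
    simp
  simp only [this]

lemma Fw_option (χ : ℤˣ →* ℤˣ) {γ : Type} [Fintype γ] [DecidableEq γ] (M : Finset γ) :
    Fw χ (M.image some) = (1 + ((χ (-1) : ℤˣ) : ℤ) * Fintype.card γ) * Fw χ M := by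
  unfold Fw
  rw [sum_perm_option]
  simp only [sep_oc, sep_ins, optionCongr_sign]
  have : ∀ (a : γ) (π : Perm γ), (if Sep M π then ((χ (Perm.sign (ins a π)) : ℤˣ) : ℤ) else 0) =
      ((χ (-1) : ℤˣ) : ℤ) * (if Sep M π then ((χ (Perm.sign π) : ℤˣ) : ℤ) else 0) := by
    intro a π
    have hs : Perm.sign (ins a π) = -1 * Perm.sign π := by
      unfold ins
      rw [Perm.sign_mul, Perm.sign_swap (by simp), optionCongr_sign]
    rw [hs, map_mul, Units.val_mul, mul_ite, mul_zero]
  simp only [this, ← Finset.mul_sum]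
  rw [sum_const, nsmul_eq_mul, card_univ]
  ring

lemma Fw_eval (χ : ℤˣ →* ℤˣ) (k : ℕ) : ∀ {γ : Type} [Fintype γ] [DecidableEq γ] (M : Finset γ),
    Fintype.card γ = M.card + k →
    Fw χ M = ∏ i ∈ range k, (1 + ((χ (-1) : ℤˣ) : ℤ) * (M.card + i : ℤ)) := by
  induction k with
  | zero =>
    intro γ _ _ M h
    have hM : M = univ := by
      rw [← card_eq_iff_eq_univ]; omega
    subst hM
    have : ∀ π : Perm γ, Sep univ π ↔ π = 1 := by
      intro π
      constructor
      · intro h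
        ext y
        by_contra hne
        exact h (π y) (mem_univ _) y (mem_univ _) hne (sc_step π y).symm
      · rintro rfl i _ j _ hij h
        exact hij (by simpa using h)
    unfold Fw
    simp [this]
  | succ k ih =>
    intro γ _ _ M h
    obtain ⟨x, hx⟩ : ∃ x, x ∉ M := by
      by_contra hc
      push Not at hc
      have := card_le_card (fun x _ => hc x : (univ : Finset γ) ⊆ M)
      rw [card_univ] at this
      omega
    let e : Option {y // y ≠ x} ≃ γ := optionSubtypeNe x
    let M' : Finset {y // y ≠ x} := M.subtype (fun y => y ≠ x)
    have hM' : M'.card = M.card := by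
      rw [Finset.card_subtype, Finset.filter_true_of_mem]
      rintro y hy rfl
      exact hx hy
    have hM : (M'.image some).image e = M := by
      ext y
      simp only [mem_image, M', mem_subtype]
      constructor
      · rintro ⟨_, ⟨z, hz, rfl⟩, rfl⟩
        simpa [e] using hz
      · intro hy
        refine ⟨some ⟨y, fun h => hx (h ▸ hy)⟩, ⟨_, hy, rfl⟩, by simp [e]⟩
    have hc : Fintype.card {y // y ≠ x} = M'.card + k := by
      rw [hM', Fintype.card_subtype_compl, Fintype.card_subtype_eq]
      omega
    rw [← hM, Fw_equiv, Fw_option, ih M' hc, hM, hM', prod_range_succ, hc, hM']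
    push_cast
    ring

lemma prod_one (m k : ℕ) :
    (m.factorial : ℤ) * ∏ i ∈ range k, (1 + (1 : ℤ) * (m + i : ℤ)) = (m + k).factorial := by
  induction k with
  | zero => simp
  | succ k ih =>
    rw [prod_range_succ, ← mul_assoc, ih, ← add_assoc, Nat.factorial_succ]
    push_cast
    ring

lemma prod_sign (m k : ℕ) :
    (m.factorial : ℤ) * ∏ i ∈ range (k + 1), (1 + (-1 : ℤ) * ((m + 1 : ℕ) + i : ℤ)) =
      (-1) ^ (k + 1) * m * (m + k).factorial := by
  induction k with
  | zero => simp; ring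
  | succ k ih =>
    rw [prod_range_succ, ← mul_assoc, ih, ← add_assoc m k 1, Nat.factorial_succ]
    push_cast
    ring

lemma full_iff {n : ℕ} (hn : 2 ≤ n) (σ : Perm (Fin n)) : Full σ ↔ σ.cycleType = {n} := by
  constructor
  · intro h
    have hm : ∀ y, σ y ≠ y := by
      intro y hy
      have : Nontrivial (Fin n) := Fin.nontrivial_iff_two_le.2 hn
      obtain ⟨z, hz⟩ := exists_ne y
      exact hz ((h y z).eq_of_left hy).symm
    have hs : σ.support = univ := by
      ext y; simp [hm y]
    have hc : σ.IsCycle := ⟨⟨0, by omega⟩, hm _, fun y _ => h _ _⟩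
    rw [hc.cycleType, hs]
    simp
  · intro h
    have hc : σ.IsCycle := by
      rw [← Perm.card_cycleType_eq_one, h]; simp
    have hs : σ.support = univ := by
      rw [← card_eq_iff_eq_univ, ← Perm.sum_cycleType, h]; simp
    intro x y
    refine hc.sameCycle ?_ ?_ <;> rw [← Perm.mem_support, hs] <;> simp

lemma isFullCycle_iff {n : ℕ} (hn : 2 ≤ n) (σ : Perm (Fin n)) : IsFullCycle σ ↔ Full σ := by
  unfold IsFullCycle cycleCount
  have hsupp : (univ.filter fun x => σ x = x).card + σ.support.card = n := by
    have := Finset.card_filter_add_card_filter_not (s := (univ : Finset (Fin n)))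
      (fun x => σ x = x)
    rw [card_univ, Fintype.card_fin] at this
    have hs : σ.support = univ.filter (fun x => ¬ σ x = x) := by
      ext y; simp
    rw [hs]; exact this
  constructor
  · intro h
    rw [full_iff hn]
    rcases Nat.eq_zero_or_pos σ.cycleType.card with h0 | h0
    · rw [Multiset.card_eq_zero, Perm.cycleType_eq_zero] at h0
      subst h0
      simp at hsupp h
      omega
    · have h1 : σ.cycleType.card = 1 := by omega
      have h2 : σ.support.card = n := by omega
      rw [Perm.card_cycleType_eq_one] at h1
      rw [h1.cycleType, h2]
  · intro h
    rw [full_iff hn] at h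
    have h2 : σ.support.card = n := by
      rw [← Perm.sum_cycleType, h]; simp
    rw [h]
    simp only [Multiset.card_singleton]
    omega

lemma card_full {n : ℕ} (hn : 2 ≤ n) :
    (univ.filter (fun v : Perm (Fin n) => Full v)).card = (n - 1).factorial := by
  have := Perm.card_of_cycleType_singleton (α := Fin n) hn (by simp)
  simp only [Fintype.card_fin, Nat.choose_self, mul_one] at this
  rw [← this]
  congr 1
  ext v
  simp [full_iff hn]

lemma card_pairs {n : ℕ} (hn : 2 ≤ n) (m : ℕ) :
    (Nat.card {p : Equiv.Perm (Fin n) × Equiv.Perm (Fin n) //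
        IsFullCycle p.1 ∧ IsFullCycle p.2 ∧ Separates m (p.1 * p.2)} : ℤ) =
      T (univ.filter (fun i : Fin n => (i : ℕ) < m)) := by
  rw [Nat.card_eq_fintype_card, Fintype.card_subtype, Finset.card_filter]
  push_cast
  rw [Fintype.sum_prod_type_right]
  unfold T
  refine Finset.sum_congr rfl fun v _ => Finset.sum_congr rfl fun u _ => ?_
  have hs : Separates m (u * v) ↔ Sep (univ.filter (fun i : Fin n => (i : ℕ) < m)) (u * v) := by
    unfold Separates Sep
    simp only [mem_filter, mem_univ, true_and]
    exact ⟨fun h i hi j hj => h i j hi hj, fun h i j hi hj => h i hi j hj⟩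
  have : (IsFullCycle u ∧ IsFullCycle v ∧ Separates m (u * v)) ↔
      (Full v ∧ Full u ∧ Sep (univ.filter (fun i : Fin n => (i : ℕ) < m)) (u * v)) := by
    rw [isFullCycle_iff hn, isFullCycle_iff hn, hs]
    tauto
  simp only [this]

theorem main_int (n m : ℕ) (hm1 : 1 ≤ m) (hm : m ≤ n) (hodd : Odd (n - m)) :
    (m.factorial : ℤ) * T (univ.filter (fun i : Fin n => (i : ℕ) < m)) =
      ((n - 1).factorial : ℤ) ^ 2 := by
  obtain ⟨r, hr⟩ := hodd
  obtain ⟨l, rfl⟩ : ∃ l, m = l + 1 := ⟨m - 1, by omega⟩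
  obtain ⟨k, hk, hk2⟩ : ∃ k, n = l + k + 1 ∧ Even (k + 1) :=
    ⟨2 * r + 1, by omega, ⟨r + 1, by omega⟩⟩
  have hn2 : 2 ≤ n := by omega
  set M : Finset (Fin n) := univ.filter (fun i : Fin n => (i : ℕ) < l + 1) with hM
  have hMc : M.card = l + 1 := by
    rw [hM, Fin.card_filter_val_lt]; omega
  have : Nonempty (Fin n) := ⟨⟨0, by omega⟩⟩
  have h1 := sum_G (α := Option (Fin n)) (by simp; omega) none (M.image some)
  rw [sum_G_option, cA_none, card_full hn2, Fintype.card_fin, hMc] at h1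
  have hMc' : (M.image some).card = l + 1 := by
    rw [card_image_of_injective _ (Option.some_injective _), hMc]
  have hcard : Fintype.card (Option (Fin n)) = (M.image some).card + (k + 1) := by
    rw [hMc', Fintype.card_option, Fintype.card_fin]; omega
  have f1 := Fw_eval 1 (k + 1) (M.image some) hcard
  have f2 := Fw_eval (MonoidHom.id _) (k + 1) (M.image some) hcard
  rw [hMc'] at f1 f2
  have hsplit : (∑ β : Perm (Option (Fin n)), if Sep (M.image some) β then
      (1 - ((Perm.sign β : ℤˣ) : ℤ)) else 0) =
      Fw 1 (M.image some) - Fw (MonoidHom.id _) (M.image some) := by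
    unfold Fw
    rw [← Finset.sum_sub_distrib]
    refine Finset.sum_congr rfl fun β _ => ?_
    split_ifs <;> simp
  rw [hsplit, f1, f2] at h1
  have p1 := prod_one (l + 1) (k + 1)
  have p2 := prod_sign l k
  rw [hk2.neg_one_pow] at p2
  simp only [MonoidHom.one_apply, Units.val_one, MonoidHom.id_apply, Units.val_neg] at h1
  set P1 := ∏ i ∈ range (k + 1), (1 + (1 : ℤ) * (((l + 1 : ℕ) : ℤ) + i : ℤ)) with hP1
  set P2 := ∏ i ∈ range (k + 1), (1 + (-1 : ℤ) * (((l + 1 : ℕ) : ℤ) + i : ℤ)) with hP2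
  have e1 : l + 1 + (k + 1) = (l + k) + 1 + 1 := by ring
  have e2 : n - 1 = l + k := by omega
  have e3 : ((l + 1).factorial : ℤ) = (l + 1) * l.factorial := by
    rw [Nat.factorial_succ]; push_cast; ring
  have e4 : ((l + k + 1 + 1).factorial : ℤ) = (l + k + 2) * (l + k + 1) * (l + k).factorial := by
    rw [Nat.factorial_succ, Nat.factorial_succ]; push_cast; ring
  have hkz : (n : ℤ) = l + k + 1 := by rw [hk]; push_cast; ring
  rw [e1, e4, e3] at p1
  rw [e2] at h1 ⊢
  rw [e3]
  rw [hkz] at h1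
  push_cast at h1
  have hne : ((k : ℤ) + 1) * (2 * l + k + 2) ≠ 0 := by positivity
  apply mul_left_cancel₀ hne
  linear_combination ((l : ℤ) + 1) * l.factorial * h1 + ((l + k).factorial : ℤ) * p1
    - ((l + k).factorial : ℤ) * ((l : ℤ) + 1) * p2

end fin

end SepOdd

/-- For `n ≥ 1` and `1 ≤ m ≤ n` with `n - m` odd, the number of ordered
pairs `(u, v)` of `n`-cycles on `[n]` whose product `u ∘ v` separates `[m]` equals
`((n-1)!)² / m!`; equivalently, `m!` times this number equals `((n-1)!)²`. -/
theorem separation_probability_odd (n m : ℕ) (hn : 1 ≤ n) (hm1 : 1 ≤ m) (hm : m ≤ n)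
    (hodd : Odd (n - m)) :
    Nat.factorial m *
      Nat.card {p : Equiv.Perm (Fin n) × Equiv.Perm (Fin n) //
        IsFullCycle p.1 ∧ IsFullCycle p.2 ∧ Separates m (p.1 * p.2)} =
    Nat.factorial (n - 1) ^ 2 := by
  have hn2 : 2 ≤ n := by
    obtain ⟨r, hr⟩ := hodd
    omega
  have h := SepOdd.main_int n m hm1 hm hodd
  rw [← SepOdd.card_pairs hn2] at h
  exact_mod_cast h
end
end
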